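/- arXiv:2511.07177 — 11 statements merged into one kernel-verified Lean document; each statement's English description precedes it below -/
import Mathlib

section
/- Let v be a valuation on a field K, L an extension field of K, and R the integral closure of the valuation ring O_v of v inside L. Then the intersection of the Jacobson radical J(R) with O_v equals the maximal ideal m_v of O_v, i.e. J(R) ∩ O_v = m_v. -/
/-- Let `v` be a valuation on a field `K`, `L` an extension field of `K`, and `R` the integral
closure of the valuation ring `𝒪_v` of `v` inside `L`.  Then `J(R) ∩ 𝒪_v = 𝔪_v`, i.e. the
preimage in `𝒪_v` of the Jacobson radical of `R` is the maximal ideal of `𝒪_v`. -/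
theorem jacobson_radical_inter_valuationSubring
    {K L Γ₀ : Type*} [Field K] [Field L] [Algebra K L]
    [LinearOrderedCommGroupWithZero Γ₀] (v : Valuation K Γ₀)
    [Algebra v.valuationSubring L] [IsScalarTower v.valuationSubring K L] :
    Ideal.comap (algebraMap v.valuationSubring (integralClosure v.valuationSubring L))
        (Ideal.jacobson (⊥ : Ideal (integralClosure v.valuationSubring L)))
      = IsLocalRing.maximalIdeal v.valuationSubring := by
  apply le_antisymm
  · apply IsLocalRing.le_maximalIdeal
    rw [Ne, Ideal.comap_eq_top_iff, Ideal.jacobson_eq_top_iff]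
    exact bot_ne_top
  · rw [← Ideal.map_le_iff_le_comap, Ideal.jacobson]
    refine le_sInf ?_
    rintro M ⟨-, hM⟩
    rw [Ideal.map_le_iff_le_comap]
    have h : (M.comap (algebraMap v.valuationSubring
        (integralClosure v.valuationSubring L))).IsMaximal :=
      Ideal.isMaximal_comap_of_isIntegral_of_isMaximal M
    exact (IsLocalRing.eq_maximalIdeal h).ge
end

section
/- Let v be a valuation on a field K, L an algebraic extension of K, and R the integral closure of the valuation ring O_v in L. If I is a prime ideal of R with I ∩ O_v = m_v, then the localization R_I of R at I is a valuation ring of L (i.e. for every nonzero x ∈ L, x ∈ R_I or x⁻¹ ∈ R_I) which extends O_v, meaning R_I ∩ K = O_v and I·R_I ∩ K = m_v. -/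
open Polynomial in
/-- If `x` is a root of a polynomial over an integrally closed subring with a coefficient outside
the prime `I`, then `x` or its inverse lies in the localization at `I`. -/
theorem aux_val {R L : Type*} [CommRing R] [Field L] [Algebra R L]
    (hint : ∀ z : L, IsIntegral R z → ∃ r : R, algebraMap R L r = z)
    (hinj : Function.Injective (algebraMap R L))
    (I : Ideal R) (x : L) (n : ℕ) : ∀ p : R[X], p.natDegree ≤ n → aeval x p = 0 →
      (∃ i, p.coeff i ∉ I) →
      ∃ a b : R, (b ∉ I ∧ algebraMap R L b * x = algebraMap R L a) ∨
        (a ∉ I ∧ algebraMap R L b * x = algebraMap R L a) := by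
  induction n with
  | zero =>
    rintro p hp h0 ⟨i, hi⟩
    rw [eq_C_of_natDegree_le_zero hp] at h0 hi
    rw [aeval_C] at h0
    have : p.coeff 0 = 0 := hinj (by rw [h0, map_zero])
    rw [this] at hi
    simp at hi
  | succ n ih =>
    rintro p hp h0 ⟨i, hi⟩
    rcases Nat.lt_or_ge p.natDegree (n+1) with h | h
    · exact ih p (by omega) h0 ⟨i, hi⟩
    have hd : p.natDegree = n + 1 := le_antisymm hp h
    obtain ⟨r, hr⟩ := hint _ (isIntegral_leadingCoeff_smul p x h0)
    rw [Algebra.smul_def] at hr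
    by_cases hc : p.leadingCoeff ∈ I
    swap
    · exact ⟨r, p.leadingCoeff, Or.inl ⟨hc, hr.symm⟩⟩
    by_cases hrI : r ∈ I
    swap
    · exact ⟨r, p.leadingCoeff, Or.inr ⟨hrI, hr.symm⟩⟩
    refine ih (p.eraseLead + monomial n r) ?_ ?_ ⟨i, ?_⟩
    · refine (natDegree_add_le _ _).trans (max_le ?_ (natDegree_monomial_le _))
      exact (eraseLead_natDegree_le p).trans (by omega)
    · have h1 := congrArg (aeval x) p.eraseLead_add_monomial_natDegree_leadingCoeff
      rw [h0, map_add, aeval_monomial, hd] at h1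
      rw [map_add, aeval_monomial, hr, ← h1]
      ring
    · intro hmem
      apply hi
      have h1 := congrArg (fun q => coeff q i) p.eraseLead_add_monomial_natDegree_leadingCoeff
      simp only [coeff_add] at h1 hmem
      rw [← h1]
      have e1 : (monomial n r).coeff i ∈ I := by
        rw [coeff_monomial]; split_ifs <;> simp [hrI]
      have e2 : (monomial p.natDegree p.leadingCoeff).coeff i ∈ I := by
        rw [coeff_monomial]; split_ifs <;> simp [hc]
      exact I.add_mem ((I.add_mem_iff_left e1).1 hmem) e2

open Polynomial in
theorem aux_poly {K L Γ₀ : Type*} [Field K] [Field L] [Algebra K L] [Algebra.IsAlgebraic K L]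
    [LinearOrderedCommGroupWithZero Γ₀] (v : Valuation K Γ₀)
    [Algebra v.valuationSubring L] [IsScalarTower v.valuationSubring K L] (x : L) :
    ∃ p : v.valuationSubring[X], aeval x p = 0 ∧ ∃ i, p.coeff i = 1 := by
  obtain ⟨q, hq0, hq⟩ := Algebra.IsAlgebraic.isAlgebraic (R := K) x
  obtain ⟨i, hi, hmax⟩ := q.support.exists_max_image (fun j => v (q.coeff j))
    (by simpa using hq0)
  have hci : q.coeff i ≠ 0 := by simpa using hi
  have hl : C (q.coeff i)⁻¹ * q ∈ lifts (algebraMap v.valuationSubring K) := by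
    rw [lifts_iff_coeff_lifts]
    intro j
    refine ⟨⟨(q.coeff i)⁻¹ * q.coeff j, ?_⟩, by rw [coeff_C_mul]; rfl⟩
    rw [Valuation.mem_valuationSubring_iff, map_mul, map_inv₀]
    by_cases hj : j ∈ q.support
    · have := hmax j hj
      have hpos : 0 < v (q.coeff i) := by simpa [zero_lt_iff] using hci
      exact (inv_mul_le_one₀ hpos).2 this
    · rw [notMem_support_iff.1 hj]; simp
  obtain ⟨p, hp⟩ := (mem_lifts _).1 hl
  refine ⟨p, ?_, i, ?_⟩
  · rw [← aeval_map_algebraMap K, hp, map_mul, hq, mul_zero]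
  · have := congrArg (fun r => coeff r i) hp
    simp only [coeff_map, coeff_C_mul, inv_mul_cancel₀ hci] at this
    exact Subtype.ext this

/-- Let `v` be a valuation on a field `K`, `L` an algebraic extension of `K`, and `R` the
integral closure of the valuation ring `𝒪_v` in `L`.  If `I` is a prime ideal of `R` with
`I ∩ 𝒪_v = 𝔪_v`, then the localization `R_I` of `R` at `I` (viewed inside `L` as the set of
fractions `a / b` with `a, b ∈ R`, `b ∉ I`) is a valuation ring of `L` extending `𝒪_v`:
it is the underlying set of a valuation subring `W` of `L` with `W ∩ K = 𝒪_v` and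
`I·R_I ∩ K = 𝔪_v`. -/
theorem localization_at_prime_is_valuation_ring_extending
    {K L Γ₀ : Type*} [Field K] [Field L] [Algebra K L] [Algebra.IsAlgebraic K L]
    [LinearOrderedCommGroupWithZero Γ₀] (v : Valuation K Γ₀)
    [Algebra v.valuationSubring L] [IsScalarTower v.valuationSubring K L]
    (I : Ideal (integralClosure v.valuationSubring L)) (hI : I.IsPrime)
    (hIv : Ideal.comap
        (algebraMap v.valuationSubring (integralClosure v.valuationSubring L)) I
      = IsLocalRing.maximalIdeal v.valuationSubring) :
    ∃ W : ValuationSubring L,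
      (W : Set L)
          = {x : L | ∃ a b : integralClosure v.valuationSubring L,
              b ∉ I ∧ (b : L) * x = (a : L)} ∧
      W.comap (algebraMap K L) = v.valuationSubring ∧
      (∀ y : K,
        (algebraMap K L y ∈ {x : L | ∃ a b : integralClosure v.valuationSubring L,
            a ∈ I ∧ b ∉ I ∧ (b : L) * x = (a : L)})
          ↔ ∃ hy : y ∈ v.valuationSubring,
              (⟨y, hy⟩ : v.valuationSubring) ∈ IsLocalRing.maximalIdeal v.valuationSubring) := by
  have hmap : ∀ (y : K) (hy : y ∈ v.valuationSubring),
      ((algebraMap v.valuationSubring (integralClosure v.valuationSubring L) ⟨y, hy⟩ : (integralClosure v.valuationSubring L)) : L) = algebraMap K L y := fun y hy =>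
    IsScalarTower.algebraMap_apply v.valuationSubring K L ⟨y, hy⟩
  have h1I : (1 : (integralClosure v.valuationSubring L)) ∉ I := fun h => hI.ne_top ((Ideal.eq_top_iff_one I).2 h)
  have hb0 : ∀ b : (integralClosure v.valuationSubring L), b ∉ I → (b : L) ≠ 0 := by
    intro b hb h
    apply hb
    have : b = 0 := Subtype.ext h
    rw [this]; exact I.zero_mem
  have key : ∀ x : L, ∃ a b : (integralClosure v.valuationSubring L), (b ∉ I ∧ (b : L) * x = a) ∨ (a ∉ I ∧ (b : L) * x = a) := by
    intro x
    obtain ⟨p, hp, i, hpi⟩ := aux_poly v x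
    refine aux_val (R := (integralClosure v.valuationSubring L)) (fun z hz => ?_) Subtype.val_injective I x
      _ (p.map (algebraMap v.valuationSubring (integralClosure v.valuationSubring L))) le_rfl ?_ ⟨i, ?_⟩
    · exact ⟨⟨z, isIntegral_trans (R := v.valuationSubring) (A := (integralClosure v.valuationSubring L)) z hz⟩, rfl⟩
    · rw [Polynomial.aeval_map_algebraMap, hp]
    · rw [Polynomial.coeff_map, hpi, map_one]; exact h1I
  have hmK : ∀ y : K, (∃ a b : (integralClosure v.valuationSubring L), b ∉ I ∧ (b : L) * algebraMap K L y = a) →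
      y ∈ v.valuationSubring := by
    rintro y ⟨a, b, hb, hab⟩
    by_contra hy
    have hy0 : y ≠ 0 := fun h => hy (h ▸ zero_mem _)
    have hyi : y⁻¹ ∈ v.valuationSubring := (v.valuationSubring.mem_or_inv_mem y).resolve_left hy
    have hm : (⟨y⁻¹, hyi⟩ : v.valuationSubring) ∈ IsLocalRing.maximalIdeal v.valuationSubring := by
      rw [IsLocalRing.mem_maximalIdeal, mem_nonunits_iff]
      intro hu
      obtain ⟨c, hc⟩ := hu.exists_right_inv
      apply hy
      have hc' : y⁻¹ * (c : K) = 1 := congrArg Subtype.val hc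
      have : y = c := by field_simp at hc'; exact hc'.symm
      rw [this]; exact c.2
    rw [← hIv, Ideal.mem_comap] at hm
    apply hb
    have : b = a * algebraMap v.valuationSubring (integralClosure v.valuationSubring L) ⟨y⁻¹, hyi⟩ := by
      apply Subtype.ext
      rw [MulMemClass.coe_mul, hmap, ← hab, mul_assoc, ← map_mul, mul_inv_cancel₀ hy0, map_one,
        mul_one]
    rw [this]
    exact I.mul_mem_left _ hm
  let W : ValuationSubring L :=
    { carrier := {x : L | ∃ a b : (integralClosure v.valuationSubring L), b ∉ I ∧ (b : L) * x = (a : L)}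
      mul_mem' := by
        rintro x y ⟨a, b, hb, h⟩ ⟨c, d, hd, h'⟩
        refine ⟨a * c, b * d, fun hh => (hI.mem_or_mem hh).elim hb hd, ?_⟩
        push_cast
        rw [← h, ← h']; ring
      one_mem' := ⟨1, 1, h1I, by simp⟩
      add_mem' := by
        rintro x y ⟨a, b, hb, h⟩ ⟨c, d, hd, h'⟩
        refine ⟨a * d + c * b, b * d, fun hh => (hI.mem_or_mem hh).elim hb hd, ?_⟩
        push_cast
        rw [← h, ← h']; ring
      zero_mem' := ⟨0, 1, h1I, by simp⟩
      neg_mem' := by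
        rintro x ⟨a, b, hb, h⟩
        refine ⟨-a, b, hb, ?_⟩
        push_cast
        rw [← h]; ring
      mem_or_inv_mem' := by
        intro x
        obtain ⟨a, b, h | h⟩ := key x
        · exact Or.inl ⟨a, b, h⟩
        · refine Or.inr ⟨b, a, h.1, ?_⟩
          have ha := hb0 a h.1
          have hx : x ≠ 0 := by
            rintro rfl
            exact ha (by rw [← h.2, mul_zero])
          rw [← h.2, mul_assoc, mul_inv_cancel₀ hx, mul_one] }
  refine ⟨W, rfl, ?_, ?_⟩
  · ext y
    rw [ValuationSubring.mem_comap]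
    refine ⟨fun h => hmK y h, fun hy => ?_⟩
    exact ⟨algebraMap v.valuationSubring (integralClosure v.valuationSubring L) ⟨y, hy⟩, 1, h1I, by rw [hmap]; simp⟩
  · intro y
    constructor
    · rintro ⟨a, b, ha, hb, hab⟩
      have hy := hmK y ⟨a, b, hb, hab⟩
      refine ⟨hy, ?_⟩
      rw [← hIv, Ideal.mem_comap]
      have : b * algebraMap v.valuationSubring (integralClosure v.valuationSubring L) ⟨y, hy⟩ = a := by
        apply Subtype.ext
        rw [MulMemClass.coe_mul, hmap, hab]
      exact (hI.mem_or_mem (this ▸ ha)).resolve_left hb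
    · rintro ⟨hy, hm⟩
      rw [← hIv, Ideal.mem_comap] at hm
      exact ⟨_, 1, hm, h1I, by rw [hmap]; simp⟩
end

section
/- Let v be a valuation on a field K, L an algebraic extension of K, and R the integral closure of the valuation ring O_v in L. If w is a valuation on L extending v (so that the valuation ring O_w of w satisfies O_w ∩ K = O_v and its maximal ideal satisfies m_w ∩ K = m_v), then m_w ∩ R is a maximal ideal of R. -/
/-- Let `v` be a valuation on a field `K`, `L` an algebraic extension of `K`, and `R` the
integral closure of the valuation ring `𝒪_v` in `L`.  If `w` is a valuation on `L` extending
`v` (i.e. `𝒪_w ∩ K = 𝒪_v`, which forces `𝔪_w ∩ K = 𝔪_v`), then `𝔪_w ∩ R` is a maximal ideal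
of `R`. -/
theorem maximalIdeal_inter_integralClosure_isMaximal
    {K L Γ₀ Γ₁ : Type*} [Field K] [Field L] [Algebra K L] [Algebra.IsAlgebraic K L]
    [LinearOrderedCommGroupWithZero Γ₀] [LinearOrderedCommGroupWithZero Γ₁]
    (v : Valuation K Γ₀) (w : Valuation L Γ₁)
    [Algebra v.valuationSubring L] [IsScalarTower v.valuationSubring K L]
    (hw : w.valuationSubring.comap (algebraMap K L) = v.valuationSubring) :
    ∃ I : Ideal (integralClosure v.valuationSubring L),
      (∀ r : integralClosure v.valuationSubring L,
        r ∈ I ↔ (r : L) ∈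
          Subtype.val '' ((IsLocalRing.maximalIdeal w.valuationSubring : Ideal w.valuationSubring)
            : Set w.valuationSubring)) ∧
      I.IsMaximal := by
  have hiff : ∀ x : K, algebraMap K L x ∈ w.valuationSubring ↔ x ∈ v.valuationSubring :=
    fun x => SetLike.ext_iff.mp hw x
  have hmem : ∀ a : v.valuationSubring, algebraMap v.valuationSubring L a ∈ w.valuationSubring := by
    intro a
    rw [IsScalarTower.algebraMap_apply v.valuationSubring K L]
    exact (hiff _).mpr a.2
  let g : v.valuationSubring →+* w.valuationSubring :=
    (algebraMap v.valuationSubring L).codRestrict w.valuationSubring.toSubring hmem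
  have hloc : IsLocalHom g := by
    constructor
    intro a ha
    obtain ⟨b, hb⟩ := isUnit_iff_exists_inv.mp ha
    have hb' : algebraMap K L (a : K) * (b : L) = 1 := by
      have h := congrArg Subtype.val hb
      have h2 : algebraMap v.valuationSubring L a * (b : L) = 1 := h
      rw [IsScalarTower.algebraMap_apply v.valuationSubring K L] at h2
      exact h2
    have ha0 : (a : K) ≠ 0 := by
      intro h0
      rw [h0] at hb'
      simp at hb'
    have hinv : (a : K)⁻¹ ∈ v.valuationSubring := by
      rw [← hiff, map_inv₀, ← eq_inv_of_mul_eq_one_right hb']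
      exact b.2
    exact isUnit_iff_exists_inv.mpr ⟨⟨_, hinv⟩, Subtype.ext (mul_inv_cancel₀ ha0)⟩
  have hR : ∀ r : integralClosure v.valuationSubring L, (r : L) ∈ w.valuationSubring := by
    intro r
    let : Algebra v.valuationSubring w.valuationSubring := g.toAlgebra
    have : IsScalarTower v.valuationSubring w.valuationSubring L :=
      IsScalarTower.of_algebraMap_eq (fun _ => rfl)
    have hr : IsIntegral v.valuationSubring (r : L) := r.2
    have hr' : IsIntegral w.valuationSubring (r : L) := hr.tower_top
    obtain ⟨y, hy⟩ := IsIntegrallyClosed.isIntegral_iff.mp hr'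
    rw [← hy]
    exact y.2
  let f : integralClosure v.valuationSubring L →+* w.valuationSubring :=
    (integralClosure v.valuationSubring L).val.toRingHom.codRestrict w.valuationSubring.toSubring hR
  refine ⟨(IsLocalRing.maximalIdeal w.valuationSubring).comap f, ?_, ?_⟩
  · intro r
    constructor
    · intro h
      exact ⟨f r, h, rfl⟩
    · rintro ⟨y, hy, hyr⟩
      have : f r = y := Subtype.ext hyr.symm
      rw [Ideal.mem_comap, this]
      exact hy
  · have : ((IsLocalRing.maximalIdeal w.valuationSubring).comap f).IsPrime :=
      Ideal.comap_isPrime f _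
    apply Ideal.isMaximal_of_isIntegral_of_isMaximal_comap (R := v.valuationSubring)
    have hfg : f.comp (algebraMap v.valuationSubring (integralClosure v.valuationSubring L)) = g :=
      rfl
    have hmax : (IsLocalRing.maximalIdeal w.valuationSubring).comap g =
        IsLocalRing.maximalIdeal v.valuationSubring :=
      ((IsLocalRing.local_hom_TFAE g).out 0 4).mp hloc
    rw [Ideal.comap_comap, hfg, hmax]
    infer_instance
end

section
/- Let v be a valuation on a field K, L an algebraic extension of K, and R the integral closure of the valuation ring O_v in L. Let w be a valuation on L extending v, and set I = m_w ∩ R, where m_w is the maximal ideal of the valuation ring O_w of w. Then the localization R_I of R at I, viewed inside L, equals O_w. -/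
open Polynomial in
/-- A nonzero element algebraic over `K` is a root of a polynomial whose coefficients have
`u`-value at most one, and which has a last coefficient (index `j`) of value one. -/
lemma aux_exists_normalized {K L Γ : Type*} [Field K] [Field L] [Algebra K L]
    [Algebra.IsAlgebraic K L] [LinearOrderedCommGroupWithZero Γ] (u : Valuation K Γ) (x : L) :
    ∃ g : K[X], aeval x g = 0 ∧ (∀ i, u (g.coeff i) ≤ 1) ∧
      ∃ j, u (g.coeff j) = 1 ∧ ∀ k, j < k → u (g.coeff k) < 1 := by
  classical
  obtain ⟨f, hf0, hf⟩ := Algebra.IsAlgebraic.isAlgebraic (R := K) x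
  obtain ⟨i, hi, hmax⟩ := f.support.exists_max_image (fun i => u (f.coeff i))
    (by simpa using hf0)
  have hi0 : f.coeff i ≠ 0 := by simpa using hi
  have hu0 : u (f.coeff i) ≠ 0 := by simpa using hi0
  have hle : ∀ k, u ((C (f.coeff i)⁻¹ * f).coeff k) ≤ 1 := by
    intro k
    rw [coeff_C_mul, map_mul, map_inv₀]
    by_cases hk : k ∈ f.support
    · rw [inv_mul_le_iff₀ (zero_lt_iff.mpr hu0), mul_one]
      exact hmax k hk
    · simp [notMem_support_iff.mp hk]
  have h1 : u ((C (f.coeff i)⁻¹ * f).coeff i) = 1 := by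
    rw [coeff_C_mul, inv_mul_cancel₀ hi0, map_one]
  refine ⟨C (f.coeff i)⁻¹ * f, by simp [hf], hle, ?_⟩
  generalize C (f.coeff i)⁻¹ * f = g at hle h1
  have hne : (g.support.filter (fun k => u (g.coeff k) = 1)).Nonempty := by
    refine ⟨i, ?_⟩
    rw [Finset.mem_filter, mem_support_iff]
    refine ⟨fun h => ?_, h1⟩
    simp [h] at h1
  obtain ⟨j, hj, hjmax⟩ := Finset.exists_max_image _ id hne
  rw [Finset.mem_filter] at hj
  refine ⟨j, hj.2, fun k hk => lt_of_le_of_ne (hle k) fun h => ?_⟩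
  have : k ≤ j := hjmax k (by
    rw [Finset.mem_filter, mem_support_iff]
    refine ⟨fun h' => ?_, h⟩
    simp [h'] at h)
  omega

/-- Let `v` be a valuation on a field `K`, `L` an algebraic extension of `K`, and `R` the
integral closure of the valuation ring `𝒪_v` in `L`.  Let `w` be a valuation on `L` extending
`v`, and set `I = 𝔪_w ∩ R`.  Then the localization `R_I` of `R` at `I`, viewed inside `L` as
the set of fractions `a / b` with `a, b ∈ R` and `b ∉ I` (i.e. `b ∉ 𝔪_w`), equals `𝒪_w`. -/
theorem localization_at_maximalIdeal_inter_eq_valuationSubring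
    {K L Γ₀ Γ₁ : Type*} [Field K] [Field L] [Algebra K L] [Algebra.IsAlgebraic K L]
    [LinearOrderedCommGroupWithZero Γ₀] [LinearOrderedCommGroupWithZero Γ₁]
    (v : Valuation K Γ₀) (w : Valuation L Γ₁)
    [Algebra v.valuationSubring L] [IsScalarTower v.valuationSubring K L]
    (hw : w.valuationSubring.comap (algebraMap K L) = v.valuationSubring) :
    (w.valuationSubring : Set L)
      = {x : L | ∃ a b : integralClosure v.valuationSubring L,
          (b : L) ∉ Subtype.val ''
            ((IsLocalRing.maximalIdeal w.valuationSubring : Ideal w.valuationSubring)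
              : Set w.valuationSubring) ∧
          (b : L) * x = (a : L)} := by

  have hu : ∀ a : K, w (algebraMap K L a) ≤ 1 ↔ v a ≤ 1 := by
    intro a
    have := SetLike.ext_iff.mp hw a
    simpa [ValuationSubring.mem_comap, Valuation.mem_valuationSubring_iff] using this
  have hmap : ∀ a : v.valuationSubring, algebraMap v.valuationSubring L a =
      algebraMap K L (a : K) := fun a =>
    IsScalarTower.algebraMap_apply v.valuationSubring K L a
  have hm : ∀ b : L, w b ≤ 1 → (b ∉ Subtype.val ''
            ((IsLocalRing.maximalIdeal w.valuationSubring : Ideal w.valuationSubring)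
              : Set w.valuationSubring) ↔ w b = 1) := by
    intro b hb
    constructor
    · intro h
      by_contra hne
      exact h ⟨⟨b, hb⟩, (Valuation.mem_maximalIdeal_iff L w).mpr (lt_of_le_of_ne hb hne), rfl⟩
    · rintro h ⟨b', hb', rfl⟩
      exact absurd h ((Valuation.mem_maximalIdeal_iff L w).mp hb').ne
  have hR : ∀ b : integralClosure v.valuationSubring L, w (b : L) ≤ 1 := by
    rintro ⟨b, p, hp, hpb⟩
    let φ : v.valuationSubring →+* w.integer :=
      (algebraMap v.valuationSubring L).codRestrict w.integer
        (fun a => by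
          rw [Valuation.mem_integer_iff, hmap, hu]
          exact a.2)
    refine (Valuation.integer.integers w).mem_of_integral (x := b) ⟨p.map φ, hp.map φ, ?_⟩
    rw [Polynomial.eval₂_map]
    exact hpb
  ext x
  simp only [SetLike.mem_coe, Valuation.mem_valuationSubring_iff, Set.mem_ofPred_eq]
  constructor
  swap
  · rintro ⟨a, b, hb, hab⟩
    have := congrArg w hab
    rw [map_mul, (hm _ (hR b)).mp hb, one_mul] at this
    rw [this]
    exact hR a
  intro hx
  rcases eq_or_ne x 0 with rfl | hx0
  · exact ⟨0, 1, (hm _ (hR 1)).mpr (by simp), by simp⟩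
  obtain ⟨g, hg, hle, j, hj, hjlt⟩ := aux_exists_normalized (w.comap (algebraMap K L)) x
  simp only [Valuation.comap_apply] at hle hj hjlt
  set c : ℕ → L := fun i => algebraMap K L (g.coeff i) with hc
  have hcR : ∀ i, c i ∈ (integralClosure v.valuationSubring L).toSubring := by
    intro i
    have : c i = algebraMap v.valuationSubring L ⟨g.coeff i, (hu _).mp (hle i)⟩ :=
      (hmap ⟨g.coeff i, (hu _).mp (hle i)⟩).symm
    rw [this]
    exact (integralClosure v.valuationSubring L).algebraMap_mem _
  set N := g.natDegree
  set y : L := ∑ k ∈ Finset.range (N + 1), c (j + k) * x ^ k with hy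
  have hsum : (∑ k ∈ Finset.range j, c k * x ^ k) + y * x ^ j = 0 := by
    have h1 := Polynomial.aeval_eq_sum_range' (p := g) (n := j + (N + 1)) (by omega) x
    rw [hg, Finset.sum_range_add] at h1
    simp only [Algebra.smul_def] at h1
    rw [h1, hy, Finset.sum_mul]
    congr 1
    refine Finset.sum_congr rfl fun k _ => ?_
    rw [pow_add]; ring
  have hyx : y * x = - ∑ k ∈ Finset.range j, c k * x⁻¹ ^ (j - 1 - k) := by
    have hxj : x ^ j ≠ 0 := pow_ne_zero _ hx0
    apply mul_right_cancel₀ hxj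
    have : y * x * x ^ j = - (∑ k ∈ Finset.range j, c k * x ^ k) * x := by
      linear_combination x * hsum
    rw [this, neg_mul, neg_mul, Finset.sum_mul, Finset.sum_mul]
    congr 1
    refine Finset.sum_congr rfl fun k hk => ?_
    have hk' := Finset.mem_range.mp hk
    have e : x ^ j = x ^ (j - 1 - k) * x ^ k * x := by
      rw [← pow_add, ← pow_succ]; congr 1; omega
    rw [e, inv_pow]
    have := pow_ne_zero (j - 1 - k) hx0
    field_simp
  have key : ∀ V : ValuationSubring L,
      (integralClosure v.valuationSubring L).toSubring ≤ V.toSubring → y ∈ V ∧ y * x ∈ V := by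
    intro V hV
    have hcV : ∀ i, c i ∈ V := fun i => hV (hcR i)
    rcases V.mem_or_inv_mem x with h | h
    · have : y ∈ V := sum_mem fun k _ => mul_mem (hcV _) (pow_mem h k)
      exact ⟨this, mul_mem this h⟩
    · have : y * x ∈ V := by
        rw [hyx]
        exact neg_mem (sum_mem fun k _ => mul_mem (hcV _) (pow_mem h _))
      refine ⟨?_, this⟩
      have h2 := mul_mem this h
      rwa [mul_assoc, mul_inv_cancel₀ hx0, mul_one] at h2
  have : IsIntegrallyClosedIn (integralClosure v.valuationSubring L).toSubring L :=
    inferInstanceAs (IsIntegrallyClosedIn (integralClosure v.valuationSubring L) L)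
  have hyR : y ∈ (integralClosure v.valuationSubring L).toSubring := by
    by_contra h
    obtain ⟨V, hV, hn⟩ := Subring.exists_le_valuationSubring_of_isIntegrallyClosedIn h
    exact hn (key V hV).1
  have hyxR : y * x ∈ (integralClosure v.valuationSubring L).toSubring := by
    by_contra h
    obtain ⟨V, hV, hn⟩ := Subring.exists_le_valuationSubring_of_isIntegrallyClosedIn h
    exact hn (key V hV).2
  refine ⟨⟨y * x, hyxR⟩, ⟨y, hyR⟩, (hm _ (hR ⟨y, hyR⟩)).mpr ?_, rfl⟩
  change w y = 1
  rw [hy, Finset.sum_range_succ', pow_zero, mul_one, add_zero]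
  have hlt : w (∑ k ∈ Finset.range N, c (j + (k + 1)) * x ^ (k + 1)) < w (c j) := by
    rw [hj]
    refine w.map_sum_lt one_ne_zero fun k _ => ?_
    rw [map_mul, map_pow]
    exact mul_lt_one_of_lt_of_le (hjlt _ (by omega)) (pow_le_one' hx _)
  rw [w.map_add_eq_of_lt_right hlt, hj]
end

section
/- Let v be a valuation on a field K, L a finite extension of K, and R the integral closure of the valuation ring O_v in L. Then the quotient R/J(R) of R by its Jacobson radical, viewed as a vector space over the residue field κ_v = O_v/m_v, satisfies dim_{κ_v}(R/J(R)) ≤ [L : K]. -/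
/-- A version of the bound for an arbitrary module quotient of the integral closure on which
the residue field acts compatibly: linearly independent families lift. -/
theorem rank_le_of_surjective_of_residue_smul.{u, w, t}
    {K : Type w} {Γ₀ : Type t} {L Q : Type u} [Field K] [Field L] [Algebra K L]
    [LinearOrderedCommGroupWithZero Γ₀] (v : Valuation K Γ₀)
    [Algebra v.valuationSubring L] [IsScalarTower v.valuationSubring K L]
    [AddCommGroup Q] [Module (IsLocalRing.ResidueField v.valuationSubring) Q]
    (π : integralClosure v.valuationSubring L →+ Q) (hπ : Function.Surjective π)
    (hsm : ∀ (a : v.valuationSubring) (r : integralClosure v.valuationSubring L),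
      IsLocalRing.residue v.valuationSubring a • π r = π (a • r)) :
    Module.rank (IsLocalRing.ResidueField v.valuationSubring) Q
      ≤ Module.rank K L := by
  rw [Module.rank_def]
  refine ciSup_le' ?_
  rintro ⟨S, hS⟩
  choose f hf using fun x : S => hπ (x : Q)
  have hli : LinearIndependent K (fun x : S => ((f x : integralClosure v.valuationSubring L) : L)) := by
    rw [linearIndependent_iff']
    intro s g hg
    by_contra! hcon
    obtain ⟨i1, hi1, hgi1⟩ := hcon
    obtain ⟨i0, hi0, hmax⟩ := s.exists_max_image (fun i => v (g i)) ⟨i1, hi1⟩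
    have h0 : g i0 ≠ 0 := by
      intro h
      have := hmax i1 hi1
      rw [h, map_zero, le_zero_iff, map_eq_zero] at this
      exact hgi1 this
    have hv0 : v (g i0) ≠ 0 := (map_ne_zero v).2 h0
    classical
    have hmem : ∀ i, (if i ∈ s then g i / g i0 else 0) ∈ v.valuationSubring := by
      intro i
      split_ifs with hi
      · rw [Valuation.mem_valuationSubring_iff, map_div₀]
        exact div_le_one_of_le₀ (hmax i hi) zero_le
      · exact zero_mem _
    let a : S → v.valuationSubring := fun i => ⟨_, hmem i⟩
    have hsum : ∑ i ∈ s, a i • f i = 0 := by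
      apply Subtype.ext
      push_cast
      have : ∀ i ∈ s, a i • (f i : L)
          = (g i0)⁻¹ • (g i • (f i : L)) := by
        intro i hi
        rw [← algebraMap_smul K (a i) (f i : L), smul_smul]
        congr 1
        change (if i ∈ s then g i / g i0 else 0) = _
        rw [if_pos hi, div_eq_inv_mul]
      rw [Finset.sum_congr rfl this, ← Finset.smul_sum, hg, smul_zero]
    have hq : ∑ i ∈ s, IsLocalRing.residue v.valuationSubring (a i) • (i : Q) = 0 := by
      have := congrArg π hsum
      rw [map_sum, map_zero] at this
      rw [← this]
      refine Finset.sum_congr rfl fun i _ => ?_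
      rw [← hsm, hf]
    have hz := linearIndependent_iff'.1 hS s _ hq i0 hi0
    have ha : a i0 = 1 := by
      apply Subtype.ext
      change (if i0 ∈ s then g i0 / g i0 else 0) = 1
      rw [if_pos hi0, div_self h0]
    rw [ha, map_one] at hz
    exact one_ne_zero hz
  exact hli.cardinal_le_rank

/-- Let `v` be a valuation on a field `K`, `L` a finite extension of `K`, and `R` the integral
closure of the valuation ring `𝒪_v` in `L`.  Then the quotient `R/J(R)` of `R` by its Jacobson
radical, viewed as a vector space over the residue field `κ_v = 𝒪_v/𝔪_v` (via the canonical map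
`φ : κ_v → R/J(R)` induced by `𝒪_v → R`), satisfies `dim_{κ_v}(R/J(R)) ≤ [L : K]`. -/
theorem rank_quotient_jacobson_le_finrank
    {K L Γ₀ : Type*} [Field K] [Field L] [Algebra K L] [FiniteDimensional K L]
    [LinearOrderedCommGroupWithZero Γ₀] (v : Valuation K Γ₀)
    [Algebra v.valuationSubring L] [IsScalarTower v.valuationSubring K L]
    (φ : IsLocalRing.ResidueField v.valuationSubring →+*
      (integralClosure v.valuationSubring L ⧸
        Ideal.jacobson (⊥ : Ideal (integralClosure v.valuationSubring L))))
    (hφ : ∀ x : v.valuationSubring,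
      φ (IsLocalRing.residue v.valuationSubring x)
        = Ideal.Quotient.mk _
            (algebraMap v.valuationSubring (integralClosure v.valuationSubring L) x)) :
    @Module.rank (IsLocalRing.ResidueField v.valuationSubring)
        (integralClosure v.valuationSubring L ⧸
          Ideal.jacobson (⊥ : Ideal (integralClosure v.valuationSubring L)))
        _ _ φ.toModule
      ≤ Module.rank K L := by
  let _ := φ.toModule
  refine rank_le_of_surjective_of_residue_smul v
    (Ideal.Quotient.mk (Ideal.jacobson
      (⊥ : Ideal (integralClosure v.valuationSubring L)))).toAddMonoidHom
    Ideal.Quotient.mk_surjective ?_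
  intro a r
  change φ _ * Ideal.Quotient.mk _ r = Ideal.Quotient.mk _ (a • r)
  rw [Algebra.smul_def a r, map_mul, ← hφ]
end

section
/- Let v be a valuation on a field K and L a finite extension of K, and let R be the integral closure of the valuation ring O_v in L. Then v has only finitely many extensions w_1, …, w_n to L, n ≥ 1, and the map r + J(R) ↦ (r + m_{w_1}, …, r + m_{w_n}) is a κ_v-algebra isomorphism R/J(R) ≅ κ_{w_1} × … × κ_{w_n}, where κ_{w_i} is the residue field of w_i. -/
open Polynomial in
/-- If `x` is a root of a polynomial with some coefficient outside `P`, then `x` is a ratio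
of two elements of `A` not both in `P`. -/
lemma aux_ratio {A L : Type*} [CommRing A] [Field L] [Algebra A L]
    (hA : ∀ y : L, IsIntegral A y → ∃ a : A, algebraMap A L a = y)
    (P : Ideal A) (x : L) (n : ℕ) :
    ∀ f : A[X], f.natDegree ≤ n → aeval x f = 0 → (∃ i, f.coeff i ∉ P) →
      ∃ r s : A, (r ∉ P ∨ s ∉ P) ∧ algebraMap A L s * x = algebraMap A L r := by
  induction n with
  | zero =>
    rintro f hf h0 ⟨i, hi⟩
    rw [Polynomial.eq_C_of_natDegree_le_zero hf] at h0 hi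
    rcases i with _ | i
    · refine ⟨0, f.coeff 0, Or.inr (by simpa using hi), ?_⟩
      have : algebraMap A L (f.coeff 0) = 0 := by simpa using h0
      simp [this]
    · exact absurd (by simp) hi
  | succ n ih =>
    rintro f hf h0 ⟨i, hi⟩
    by_cases hd : f.natDegree ≤ n
    · exact ih f hd h0 ⟨i, hi⟩
    have hd' : f.natDegree = n + 1 := by omega
    obtain ⟨b, hb⟩ := hA _ (isIntegral_leadingCoeff_smul f x h0)
    rw [Algebra.smul_def] at hb
    by_cases hP : b ∉ P ∨ f.leadingCoeff ∉ P
    · exact ⟨b, f.leadingCoeff, hP, hb.symm⟩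
    push Not at hP
    have hc : f.leadingCoeff = f.coeff (n + 1) := by rw [leadingCoeff, hd']
    have hdeg : (f.eraseLead + monomial n b).natDegree ≤ n := by
      refine (natDegree_add_le _ _).trans (max_le ?_ (natDegree_monomial_le _))
      exact (eraseLead_natDegree_le f).trans (by omega)
    refine ih _ hdeg ?_ ⟨i, ?_⟩
    · have h1 := eraseLead_add_monomial_natDegree_leadingCoeff f
      rw [← h1, map_add, hd', aeval_monomial, pow_succ', ← mul_assoc, ← hb] at h0
      rw [map_add, aeval_monomial]
      exact h0
    · rw [coeff_add, coeff_monomial]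
      have hin : i ≠ n + 1 := by
        rintro rfl
        exact hi (hc ▸ hP.2)
      rw [eraseLead_coeff_of_ne _ (by rw [hd']; exact hin)]
      intro h
      apply hi
      split_ifs at h with hni
      · simpa using P.sub_mem h hP.1
      · simpa using h

/-- Normalising a nonzero finite family of elements of a valued field. -/
lemma aux_normalize {K Γ₀ O ι : Type*} [Field K] [LinearOrderedCommGroupWithZero Γ₀]
    {v : Valuation K Γ₀} [CommRing O] [Algebra O K] (hv : v.Integers O)
    [Finite ι] (a : ι → K) (ha : ∃ i, a i ≠ 0) :
    ∃ (c : K) (b : ι → O), (∀ i, algebraMap O K (b i) = c * a i) ∧ ∃ j, b j = 1 := by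
  obtain ⟨i0, hi0⟩ := ha
  have : Nonempty ι := ⟨i0⟩
  obtain ⟨j, hj⟩ := Finite.exists_max (fun i => v (a i))
  have hj0 : a j ≠ 0 := by
    intro h
    have := hj i0
    simp only [h, map_zero, le_zero_iff, map_eq_zero] at this
    exact hi0 this
  have hvj : v (a j) ≠ 0 := by simpa using hj0
  have : ∀ i, ∃ b : O, algebraMap O K b = (a j)⁻¹ * a i := by
    intro i
    apply hv.exists_of_le_one
    rw [map_mul, map_inv₀]
    calc (v (a j))⁻¹ * v (a i) ≤ (v (a j))⁻¹ * v (a j) := by gcongr; exact hj i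
      _ = 1 := inv_mul_cancel₀ hvj
  choose b hb using this
  refine ⟨_, b, hb, j, hv.hom_inj ?_⟩
  rw [hb, inv_mul_cancel₀ hj0, map_one]

open Polynomial in
/-- Every element of `L` is a ratio of elements of the integral closure, not both in `P`. -/
lemma aux_ratio' {K L Γ₀ O : Type*} [Field K] [Field L] [Algebra K L] [FiniteDimensional K L]
    [LinearOrderedCommGroupWithZero Γ₀]
    {v : Valuation K Γ₀} [CommRing O] [Algebra O K] (hv : v.Integers O)
    [Algebra O L] [IsScalarTower O K L]
    (P : Ideal (integralClosure O L)) (hP : P ≠ ⊤) (x : L) :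
    ∃ r s : integralClosure O L, (r ∉ P ∨ s ∉ P) ∧ (s : L) * x = r := by
  have hx : IsIntegral K x := Algebra.IsIntegral.isIntegral x
  set p := minpoly K x with hp
  obtain ⟨c, b, hb, j, hj⟩ := aux_normalize hv (fun i : Fin (p.natDegree + 1) => p.coeff i)
    ⟨Fin.last _, by simpa using minpoly.ne_zero hx⟩
  let f : (integralClosure O L)[X] :=
    ∑ i : Fin (p.natDegree + 1), monomial (i : ℕ) (algebraMap O (integralClosure O L) (b i))
  have hA : ∀ y : L, IsIntegral (integralClosure O L) y →
      ∃ a : integralClosure O L, algebraMap (integralClosure O L) L a = y := by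
    intro y hy
    exact ⟨⟨y, isIntegral_trans y hy⟩, rfl⟩
  refine aux_ratio hA P x f.natDegree f le_rfl ?_ ⟨j, ?_⟩
  · have h0 : aeval x p = 0 := minpoly.aeval K x
    rw [aeval_eq_sum_range, Finset.sum_range] at h0
    simp only [f, map_sum, aeval_monomial]
    have : ∀ i : Fin (p.natDegree + 1),
        algebraMap (integralClosure O L) L (algebraMap O (integralClosure O L) (b i)) * x ^ (i : ℕ)
          = algebraMap K L c * (p.coeff i • x ^ (i : ℕ)) := by
      intro i
      rw [← IsScalarTower.algebraMap_apply, IsScalarTower.algebraMap_apply O K L, hb, map_mul,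
        Algebra.smul_def, mul_assoc]
    rw [Finset.sum_congr rfl (fun i _ => this i), ← Finset.mul_sum, h0, mul_zero]
  · have : f.coeff j = 1 := by
      simp only [f, finsetSum_coeff, coeff_monomial]
      rw [Finset.sum_eq_single j]
      · simp [hj]
      · intro i _ hij
        rw [if_neg]
        exact fun h => hij (Fin.ext h)
      · simp
    rw [this]
    exact fun h => hP ((Ideal.eq_top_iff_one _).2 h)

/-- The integral closure has finitely many maximal ideals. -/
lemma aux_finite {K L Γ₀ O : Type*} [Field K] [Field L] [Algebra K L] [FiniteDimensional K L]
    [LinearOrderedCommGroupWithZero Γ₀]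
    {v : Valuation K Γ₀} [CommRing O] [Algebra O K] (hv : v.Integers O)
    [Algebra O L] [IsScalarTower O K L] :
    Finite (MaximalSpectrum (integralClosure O L)) := by
  classical
  by_contra hinf
  rw [not_finite_iff_infinite] at hinf
  obtain ⟨s, hs⟩ := Infinite.exists_subset_card_eq
    (MaximalSpectrum (integralClosure O L)) (Module.finrank K L + 1)
  have hcop : Pairwise (fun i j : s => IsCoprime i.1.asIdeal j.1.asIdeal) := by
    intro i j hij
    have := i.1.isMaximal
    have := j.1.isMaximal
    apply Ideal.isCoprime_of_isMaximal
    intro h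
    exact hij (Subtype.ext (MaximalSpectrum.ext h))
  have := fun i : s => Ideal.exists_forall_sub_mem_ideal (I := fun i : s => i.1.asIdeal) hcop
    (fun j => if i = j then 1 else 0)
  choose e he using this
  have hli : LinearIndependent K (fun i : s => (e i : L)) := by
    rw [Fintype.linearIndependent_iff]
    intro g hg
    by_contra hne
    push Not at hne
    obtain ⟨c, b, hb, j, hj⟩ := aux_normalize hv g hne
    have h0 : ∑ i, algebraMap O (integralClosure O L) (b i) * e i = 0 := by
      apply Subtype.ext
      have : ∀ i, ((algebraMap O (integralClosure O L) (b i) * e i : integralClosure O L) : L)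
          = algebraMap K L c * (g i • (e i : L)) := by
        intro i
        change algebraMap O L (b i) * (e i : L) = _
        rw [IsScalarTower.algebraMap_apply O K L, hb, map_mul, Algebra.smul_def, mul_assoc]
      rw [AddSubmonoidClass.coe_finsetSum, Finset.sum_congr rfl (fun i _ => this i),
        ← Finset.mul_sum, hg, mul_zero]
      rfl
    have h1 : (1 : integralClosure O L) ∈ j.1.asIdeal := by
      have h2 : ∑ i, algebraMap O (integralClosure O L) (b i) * (e i - if i = j then 1 else 0)
          ∈ j.1.asIdeal := Ideal.sum_mem _ fun i _ => Ideal.mul_mem_left _ _ (he i j)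
      simp only [mul_sub, Finset.sum_sub_distrib, h0] at h2
      simpa [hj] using h2
    exact j.1.isMaximal.ne_top ((Ideal.eq_top_iff_one _).2 h1)
  have := hli.fintype_card_le_finrank
  simp [hs] at this

/-- The map from the integral closure to the residue field of `W`. -/
noncomputable def auxRes {O L : Type*} [Field L] [CommRing O] [Algebra O L] (W : ValuationSubring L)
    (hW : ∀ x : L, IsIntegral O x → x ∈ W) :
    integralClosure O L →+* IsLocalRing.ResidueField W :=
  (IsLocalRing.residue W).comp
    { toFun := fun r => ⟨(r : L), hW r r.2⟩
      map_one' := rfl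
      map_mul' := fun _ _ => rfl
      map_zero' := rfl
      map_add' := fun _ _ => rfl }

lemma auxRes_apply {O L : Type*} [Field L] [CommRing O] [Algebra O L] (W : ValuationSubring L)
    (hW : ∀ x : L, IsIntegral O x → x ∈ W) (r : integralClosure O L) :
    auxRes W hW r = IsLocalRing.residue W ⟨(r : L), hW r r.2⟩ := rfl

lemma auxRes_mem_ker {O L : Type*} [Field L] [CommRing O] [Algebra O L] (W : ValuationSubring L)
    (hW : ∀ x : L, IsIntegral O x → x ∈ W) (r : integralClosure O L) :
    r ∈ RingHom.ker (auxRes W hW) ↔ W.valuation (r : L) < 1 := by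
  rw [RingHom.mem_ker, auxRes_apply, IsLocalRing.residue_eq_zero_iff,
    ValuationSubring.valuation_lt_one_iff]

section
variable {K L Γ₀ O : Type*} [Field K] [Field L] [Algebra K L] [FiniteDimensional K L]
    [LinearOrderedCommGroupWithZero Γ₀]
    {v : Valuation K Γ₀} [CommRing O] [Algebra O K]
    [Algebra O L] [IsScalarTower O K L]

/-- Elements of `W` are fractions with denominator outside the centre of `W`. -/
lemma aux_mem_iff (hv : v.Integers O) (W : ValuationSubring L)
    (hW : ∀ x : L, IsIntegral O x → x ∈ W) (x : L) :
    x ∈ W ↔ ∃ r s : integralClosure O L, s ∉ RingHom.ker (auxRes W hW) ∧ (s : L) * x = r := by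
  have hle : ∀ r : integralClosure O L, W.valuation (r : L) ≤ 1 := fun r =>
    (W.valuation_le_one_iff _).2 (hW _ r.2)
  constructor
  · intro hx
    obtain ⟨r, s, hrs, h⟩ := aux_ratio' hv (RingHom.ker (auxRes W hW)) (RingHom.ker_ne_top _) x
    refine ⟨r, s, ?_, h⟩
    rcases hrs with hr | hs
    · intro hs
      apply hr
      rw [auxRes_mem_ker] at hs ⊢
      rw [← h, map_mul]
      exact mul_lt_one_of_lt_of_le hs ((W.valuation_le_one_iff _).2 hx)
    · exact hs
  · rintro ⟨r, s, hs, h⟩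
    rw [auxRes_mem_ker, not_lt] at hs
    have hs1 := le_antisymm (hle s) hs
    rw [← W.valuation_le_one_iff]
    have := hle r
    rwa [← h, map_mul, hs1, one_mul] at this

lemma auxRes_surjective (hv : v.Integers O) (W : ValuationSubring L)
    (hW : ∀ x : L, IsIntegral O x → x ∈ W) (hmax : (RingHom.ker (auxRes W hW)).IsMaximal) :
    Function.Surjective (auxRes W hW) := by
  intro y
  obtain ⟨⟨x, hx⟩, rfl⟩ := IsLocalRing.residue_surjective y
  obtain ⟨r, s, hs, h⟩ := (aux_mem_iff hv W hW x).1 hx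
  obtain ⟨t, ht⟩ := hmax.exists_inv hs
  obtain ⟨i, hi, hti⟩ := ht
  refine ⟨t * r, ?_⟩
  have h1 : auxRes W hW r = auxRes W hW s * IsLocalRing.residue W ⟨x, hx⟩ := by
    rw [auxRes_apply, auxRes_apply, ← map_mul]
    congr 1
    exact Subtype.ext h.symm
  have h2 : auxRes W hW t * auxRes W hW s = 1 := by
    have := congrArg (auxRes W hW) hti
    rwa [map_add, (RingHom.mem_ker).1 hi, add_zero, map_mul, map_one] at this
  rw [map_mul, h1, ← mul_assoc, h2, one_mul]

end

/-- Let `v` be a valuation on a field `K`, `L` a finite extension of `K`, and `R` the integral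
closure of the valuation ring `𝒪_v` in `L`.  Then `v` has finitely many (and at least one)
extensions `w₁, …, w_n` to `L` (identified with the valuation rings of `L` lying over `𝒪_v`),
and the map `r + J(R) ↦ (r + 𝔪_{w₁}, …, r + 𝔪_{w_n})` is an isomorphism
`R/J(R) ≅ κ_{w₁} × ⋯ × κ_{w_n}`. -/
theorem quotient_jacobson_iso_product_of_residue_fields
    {K L Γ₀ : Type*} [Field K] [Field L] [Algebra K L] [FiniteDimensional K L]
    [LinearOrderedCommGroupWithZero Γ₀] (v : Valuation K Γ₀)
    [Algebra v.valuationSubring L] [IsScalarTower v.valuationSubring K L] :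
    ∃ (n : ℕ) (_ : 0 < n) (W : Fin n → ValuationSubring L),
      (∀ i, (W i).comap (algebraMap K L) = v.valuationSubring) ∧
      (∀ i j, i ≠ j → W i ≠ W j) ∧
      (∀ W' : ValuationSubring L,
        W'.comap (algebraMap K L) = v.valuationSubring → ∃ i, W' = W i) ∧
      ∃ (hmem : ∀ (i) (x : L), IsIntegral v.valuationSubring x → x ∈ W i)
        (e : (integralClosure v.valuationSubring L ⧸
            Ideal.jacobson (⊥ : Ideal (integralClosure v.valuationSubring L)))
          ≃+* ((i : Fin n) → IsLocalRing.ResidueField (W i))),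
        ∀ (r : integralClosure v.valuationSubring L) (i : Fin n),
          e (Ideal.Quotient.mk _ r) i
            = IsLocalRing.residue (W i) ⟨(r : L), hmem i (r : L) r.2⟩ := by
  have hv : v.Integers v.valuationSubring := Valuation.valuationSubring.integers v
  have hcomp : ∀ a : v.valuationSubring,
      algebraMap v.valuationSubring L a = algebraMap K L (a : K) := fun a =>
    IsScalarTower.algebraMap_apply v.valuationSubring K L a
  have hmem : ∀ W : ValuationSubring L, (∀ a : v.valuationSubring, algebraMap K L (a : K) ∈ W) →
      ∀ x : L, IsIntegral v.valuationSubring x → x ∈ W := by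
    intro W hW x hx
    obtain ⟨p, hp, hpx⟩ := hx
    let g : v.valuationSubring →+* W := (algebraMap v.valuationSubring L).codRestrict W.toSubring
      (fun a => by rw [hcomp]; exact hW a)
    have hx' : IsIntegral W x := by
      refine ⟨p.map g, hp.map g, ?_⟩
      rw [Polynomial.eval₂_map]
      exact hpx
    obtain ⟨y, hy⟩ := IsIntegrallyClosed.isIntegral_iff.1 hx'
    rw [← hy]
    exact y.2
  have hO : ∀ W : ValuationSubring L, W.comap (algebraMap K L) = v.valuationSubring →
      ∀ a : v.valuationSubring, algebraMap K L (a : K) ∈ W := by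
    intro W hW a
    have h : (a : K) ∈ W.comap (algebraMap K L) := hW.ge a.2
    exact h
  -- kernels are maximal
  have hmax : ∀ (W : ValuationSubring L) (hW : W.comap (algebraMap K L) = v.valuationSubring),
      (RingHom.ker (auxRes W (hmem W (hO W hW)))).IsMaximal := by
    intro W hW
    have := RingHom.ker_isPrime (auxRes W (hmem W (hO W hW)))
    apply Ideal.isMaximal_of_isIntegral_of_isMaximal_comap (R := v.valuationSubring)
    have : Ideal.comap (algebraMap v.valuationSubring (integralClosure v.valuationSubring L))
        (RingHom.ker (auxRes W (hmem W (hO W hW)))) =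
        IsLocalRing.maximalIdeal v.valuationSubring := by
      apply le_antisymm
      · exact IsLocalRing.le_maximalIdeal (Ideal.comap_ne_top _ (RingHom.ker_ne_top _))
      · intro a ha
        rw [Ideal.mem_comap, auxRes_mem_ker]
        change W.valuation (algebraMap v.valuationSubring L a) < 1
        rw [hcomp]
        by_contra hlt
        rw [not_lt] at hlt
        have h0 : (a : K) ≠ 0 := by
          intro h
          rw [h, map_zero, map_zero] at hlt
          exact absurd hlt (by simp)
        have h1 : (a : K)⁻¹ ∈ W.comap (algebraMap K L) := by
          rw [ValuationSubring.mem_comap, ← ValuationSubring.valuation_le_one_iff, map_inv₀,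
            map_inv₀]
          exact inv_le_one_of_one_le₀ hlt
        rw [hW] at h1
        rw [IsLocalRing.mem_maximalIdeal] at ha
        exact ha (IsUnit.of_mul_eq_one ⟨_, h1⟩ (Subtype.ext (mul_inv_cancel₀ h0)))
    rw [this]
    infer_instance
  -- existence
  have hex : ∀ m : MaximalSpectrum (integralClosure v.valuationSubring L),
      ∃ (W : ValuationSubring L) (hW : W.comap (algebraMap K L) = v.valuationSubring),
        RingHom.ker (auxRes W (hmem W (hO W hW))) = m.asIdeal := by
    intro m
    obtain ⟨W, hRW, hmW⟩ := Ideal.image_subset_nonunits_valuationSubring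
      (A := (integralClosure v.valuationSubring L).toSubring) m.asIdeal m.isMaximal.ne_top
    have hmW' : ∀ r : integralClosure v.valuationSubring L, r ∈ m.asIdeal →
        W.valuation (r : L) < 1 := by
      intro r hr
      exact W.mem_nonunits_iff.1 (hmW ⟨r, hr, rfl⟩)
    have hW : W.comap (algebraMap K L) = v.valuationSubring := by
      ext x
      rw [ValuationSubring.mem_comap]
      constructor
      · intro hx
        by_contra hxv
        have hinv : x⁻¹ ∈ v.valuationSubring := (v.valuationSubring.mem_or_inv_mem x).resolve_left hxv
        have hx0 : x ≠ 0 := by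
          rintro rfl
          exact hxv (zero_mem _)
        have hnu : (⟨x⁻¹, hinv⟩ : v.valuationSubring) ∈
            IsLocalRing.maximalIdeal v.valuationSubring := by
          rw [IsLocalRing.mem_maximalIdeal]
          intro hu
          obtain ⟨y, hy⟩ := hu.exists_right_inv
          have hy' : x⁻¹ * (y : K) = 1 := congrArg Subtype.val hy
          have : x = y := by
            field_simp at hy'
            exact hy'.symm
          exact hxv (this ▸ y.2)
        have := m.isMaximal
        have hc := Ideal.isMaximal_comap_of_isIntegral_of_isMaximal (R := v.valuationSubring)
          m.asIdeal
        rw [← IsLocalRing.eq_maximalIdeal hc] at hnu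
        have h1 := hmW' _ hnu
        change W.valuation (algebraMap v.valuationSubring L _) < 1 at h1
        rw [hcomp] at h1
        change W.valuation (algebraMap K L x⁻¹) < 1 at h1
        have h2 := (W.valuation_le_one_iff _).2 hx
        have h3 : W.valuation (algebraMap K L x⁻¹) * W.valuation (algebraMap K L x) = 1 := by
          rw [← map_mul, ← map_mul, inv_mul_cancel₀ hx0, map_one, map_one]
        exact absurd h3 (mul_lt_one_of_lt_of_le h1 h2).ne
      · intro hx
        have := hRW (algebraMap v.valuationSubring (integralClosure v.valuationSubring L)
          ⟨x, hx⟩).2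
        change algebraMap v.valuationSubring L ⟨x, hx⟩ ∈ W at this
        rwa [hcomp] at this
    refine ⟨W, hW, ?_⟩
    symm
    apply m.isMaximal.eq_of_le (RingHom.ker_ne_top _)
    intro r hr
    rw [auxRes_mem_ker]
    exact hmW' r hr
  have hfin : Finite (MaximalSpectrum (integralClosure v.valuationSubring L)) := aux_finite hv
  choose W0 hW0 hker0 using hex
  obtain ⟨n, ⟨E⟩⟩ := Finite.exists_equiv_fin (MaximalSpectrum (integralClosure v.valuationSubring L))
  have hn : 0 < n := by
    have : Nonempty (MaximalSpectrum (integralClosure v.valuationSubring L)) := inferInstance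
    exact Fin.pos (E this.some)
  have hcop : Pairwise (Function.onFun IsCoprime (fun i : Fin n => (E.symm i).asIdeal)) := by
    intro i j hij
    have := (E.symm i).isMaximal
    have := (E.symm j).isMaximal
    apply Ideal.isCoprime_of_isMaximal
    intro h
    exact hij (E.symm.injective (MaximalSpectrum.ext h))
  have hmem' : ∀ (i : Fin n) (x : L), IsIntegral v.valuationSubring x → x ∈ W0 (E.symm i) :=
    fun i => hmem _ (hO _ (hW0 _))
  refine ⟨n, hn, fun i => W0 (E.symm i), fun i => hW0 _, ?_, ?_, hmem', ?_⟩
  · intro i j hij h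
    apply hij
    apply E.symm.injective
    apply MaximalSpectrum.ext
    rw [← hker0, ← hker0]
    ext r
    rw [auxRes_mem_ker, auxRes_mem_ker]
    have h' : W0 (E.symm i) = W0 (E.symm j) := h
    rw [h']
  · intro W' hW'
    refine ⟨E ⟨_, hmax W' hW'⟩, ?_⟩
    beta_reduce
    rw [Equiv.symm_apply_apply]
    ext x
    rw [aux_mem_iff hv W' (hmem W' (hO W' hW')), aux_mem_iff hv _ (hmem _ (hO _ (hW0 _))), hker0]
  · let Φ : integralClosure v.valuationSubring L →+*
        ((i : Fin n) → IsLocalRing.ResidueField (W0 (E.symm i))) :=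
      RingHom.pi fun i => auxRes (W0 (E.symm i)) (hmem' i)
    have hsurj : Function.Surjective Φ := by
      intro y
      have := fun i : Fin n => auxRes_surjective hv (W0 (E.symm i)) (hmem' i)
        (hmax _ (hW0 _)) (y i)
      choose z hz using this
      obtain ⟨r, hr⟩ := Ideal.exists_forall_sub_mem_ideal hcop z
      refine ⟨r, funext fun i => ?_⟩
      have h1 := hr i
      rw [← hker0, RingHom.mem_ker, map_sub, sub_eq_zero, hz] at h1
      exact h1
    have hkerΦ : Ideal.jacobson (⊥ : Ideal (integralClosure v.valuationSubring L)) =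
        RingHom.ker Φ := by
      ext r
      rw [Ideal.jacobson, Ideal.mem_sInf, RingHom.mem_ker, funext_iff]
      constructor
      · intro h i
        have h1 := h ⟨bot_le, (E.symm i).isMaximal⟩
        rw [← hker0] at h1
        exact h1
      · rintro h I ⟨-, hI⟩
        have h1 : r ∈ RingHom.ker (auxRes (W0 (E.symm (E ⟨I, hI⟩))) (hmem' (E ⟨I, hI⟩))) :=
          h (E ⟨I, hI⟩)
        rw [hker0, Equiv.symm_apply_apply] at h1
        exact h1
    refine ⟨(Ideal.quotEquivOfEq hkerΦ).trans (RingHom.quotientKerEquivOfSurjective hsurj), ?_⟩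
    intro r i
    rfl
end

section
/- Let v be a valuation on a field K, L a finite extension of K, and w_1, …, w_n pairwise distinct extensions of v to L. Then the sum of the residue degrees satisfies Σ_{i=1}^n [κ_{w_i} : κ_v] ≤ [L : K]. -/
lemma aux_val_lt {K L Γ₀ : Type*} [Field K] [Field L] [Algebra K L]
    [LinearOrderedCommGroupWithZero Γ₀] (v : Valuation K Γ₀) (W : ValuationSubring L)
    (hW : W.comap (algebraMap K L) = v.valuationSubring) (c : K) (hc : v c < 1) :
    W.valuation (algebraMap K L c) < 1 := by
  rw [← ValuationSubring.mem_nonunits_iff, ValuationSubring.mem_nonunits_iff_or]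
  by_cases h0 : c = 0
  · left; simp [h0]
  · right
    rw [← map_inv₀]
    intro h
    have h2 : c⁻¹ ∈ v.valuationSubring := by rw [← hW]; exact h
    rw [Valuation.mem_valuationSubring_iff, map_inv₀] at h2
    have h3 : v c ≠ 0 := (Valuation.ne_zero_iff v).2 h0
    have h4 : 1 < (v c)⁻¹ := (one_lt_inv₀ (zero_lt_iff.2 h3)).2 hc
    exact absurd h2 (not_le.2 h4)

lemma aux_key {K L Γ₀ : Type*} [Field K] [Field L] [Algebra K L] [FiniteDimensional K L]
    [LinearOrderedCommGroupWithZero Γ₀] (v : Valuation K Γ₀) (a : L) :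
    ∃ u w : L, u * a = w ∧
      ∀ W : ValuationSubring L, W.comap (algebraMap K L) = v.valuationSubring →
        u ∈ W ∧ w ∈ W ∧ (a ∈ W → W.valuation (u - 1) < 1) := by
  classical
  by_cases ha : a = 0
  · refine ⟨1, 0, by simp [ha], fun W _ => ⟨W.one_mem, W.zero_mem, fun _ => by simp⟩⟩
  set p := minpoly K a with hp
  have hp0 : p ≠ 0 := minpoly.ne_zero (Algebra.IsIntegral.isIntegral a)
  obtain ⟨j, hj, hmax⟩ := Finset.exists_max_image p.support
    (fun k => toLex (v (p.coeff k), k)) (Polynomial.support_nonempty.2 hp0)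
  have hj0 : p.coeff j ≠ 0 := Polynomial.mem_support_iff.1 hj
  have hvj : v (p.coeff j) ≠ 0 := (Valuation.ne_zero_iff v).2 hj0
  set c : ℕ → K := fun k => p.coeff k / p.coeff j with hc
  have hcj : c j = 1 := div_self hj0
  have hc1 : ∀ k ∈ p.support, v (c k) ≤ 1 := by
    intro k hk
    have h := (Prod.Lex.le_iff.1 (hmax k hk))
    simp only [hc, map_div₀]
    apply div_le_one_of_le₀ _ zero_le
    rcases h with h | h
    · exact h.le
    · exact h.1.le
  have hc2 : ∀ k ∈ p.support, j < k → v (c k) < 1 := by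
    intro k hk hjk
    have h := (Prod.Lex.le_iff.1 (hmax k hk))
    simp only [hc, map_div₀]
    rw [div_lt_one₀ (zero_lt_iff.2 hvj)]
    rcases h with h | h
    · exact h
    · exact absurd h.2 (not_le.2 hjk)
  have hsum : ∑ k ∈ p.support, algebraMap K L (c k) * a ^ k = 0 := by
    have h := minpoly.aeval K a
    rw [← hp, Polynomial.aeval_def, Polynomial.eval₂_eq_sum, Polynomial.sum_def] at h
    have e : ∑ k ∈ p.support, algebraMap K L (c k) * a ^ k =
        algebraMap K L (p.coeff j)⁻¹ * ∑ k ∈ p.support, algebraMap K L (p.coeff k) * a ^ k := by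
      rw [Finset.mul_sum]
      refine Finset.sum_congr rfl fun k _ => ?_
      simp only [hc, div_eq_inv_mul, map_mul, mul_assoc]
    rw [e, h, mul_zero]
  set u : L := ∑ k ∈ p.support with j ≤ k, algebraMap K L (c k) * a ^ (k - j) with hu
  set w : L := - ∑ k ∈ p.support with ¬ j ≤ k, algebraMap K L (c k) * a⁻¹ ^ (j - 1 - k) with hw
  have huw : u * a = w := by
    have haj : a ^ j ≠ 0 := pow_ne_zero _ ha
    apply mul_right_cancel₀ haj
    have e1 : u * a * a ^ j = a * ∑ k ∈ p.support with j ≤ k, algebraMap K L (c k) * a ^ k := by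
      rw [hu, mul_assoc, Finset.sum_mul, Finset.mul_sum]
      refine Finset.sum_congr rfl fun k hk => ?_
      have hk2 := (Finset.mem_filter.1 hk).2
      obtain ⟨d, rfl⟩ := Nat.exists_eq_add_of_le hk2
      rw [Nat.add_sub_cancel_left]; ring
    have e2 : w * a ^ j = - (a * ∑ k ∈ p.support with ¬ j ≤ k, algebraMap K L (c k) * a ^ k) := by
      rw [hw, neg_mul, Finset.sum_mul, Finset.mul_sum]
      congr 1
      refine Finset.sum_congr rfl fun k hk => ?_
      have hk2 := (Finset.mem_filter.1 hk).2
      obtain ⟨d, rfl⟩ := Nat.exists_eq_add_of_lt (not_le.1 hk2)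
      have : k + d + 1 - 1 - k = d := by omega
      rw [this]
      have h2 : a⁻¹ ^ d * a ^ d = 1 := by rw [← mul_pow, inv_mul_cancel₀ ha, one_pow]
      linear_combination (algebraMap K L (c k) * a ^ (k + 1)) * h2
    rw [e1, e2, ← Finset.sum_filter_add_sum_filter_not p.support (fun k => j ≤ k)] at *
    linear_combination a * hsum
  refine ⟨u, w, huw, fun W hW => ?_⟩
  have hcW : ∀ k ∈ p.support, algebraMap K L (c k) ∈ W := by
    intro k hk
    have : c k ∈ W.comap (algebraMap K L) := by
      rw [hW, Valuation.mem_valuationSubring_iff]; exact hc1 k hk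
    exact this
  have hmem : u ∈ W ∧ w ∈ W := by
    rcases W.mem_or_inv_mem a with h | h
    · have : u ∈ W := sum_mem fun k hk =>
        mul_mem (hcW k (Finset.mem_filter.1 hk).1) (pow_mem h _)
      exact ⟨this, huw ▸ mul_mem this h⟩
    · have : w ∈ W := neg_mem (sum_mem fun k hk =>
        mul_mem (hcW k (Finset.mem_filter.1 hk).1) (pow_mem h _))
      refine ⟨?_, this⟩
      have e : u = w * a⁻¹ := by rw [← huw, mul_assoc, mul_inv_cancel₀ ha, mul_one]
      rw [e]; exact mul_mem this h
  refine ⟨hmem.1, hmem.2, fun haW => ?_⟩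
  have hj' : j ∈ p.support.filter (fun k => j ≤ k) := Finset.mem_filter.2 ⟨hj, le_rfl⟩
  have e : u - 1 = ∑ k ∈ (p.support.filter (fun k => j ≤ k)).erase j,
      algebraMap K L (c k) * a ^ (k - j) := by
    rw [hu, ← Finset.add_sum_erase _ _ hj', hcj]; simp
  rw [e]
  refine Valuation.map_sum_lt _ one_ne_zero fun k hk => ?_
  obtain ⟨h1, h2⟩ := Finset.mem_erase.1 hk
  obtain ⟨h2, h3⟩ := Finset.mem_filter.1 h2
  rw [map_mul]
  exact mul_lt_one_of_lt_of_le (aux_val_lt v W hW _ (hc2 k h2 (lt_of_le_of_ne h3 (Ne.symm h1))))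
    ((W.valuation_le_one_iff _).2 (pow_mem haW _))

lemma aux_res {L : Type*} [Field L] (W : ValuationSubring L) (x : W) :
    IsLocalRing.residue W x = 0 ↔ W.valuation (x : L) < 1 := by
  rw [IsLocalRing.residue_eq_zero_iff, ValuationSubring.valuation_lt_one_iff]

lemma aux_card : ∀ (n : ℕ) (f : Fin n → Type*),
    Cardinal.mk (Σ i, f i) = ∑ i, Cardinal.mk (f i)
  | 0, f => by simp
  | n + 1, f => by
    rw [Fin.sum_univ_succ, ← aux_card n (fun i => f i.succ), Cardinal.add_def]
    refine Cardinal.mk_congr ⟨fun q => Fin.cases (motive := fun i => f i → f 0 ⊕ Σ i : Fin n, f i.succ)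
      (fun y => Sum.inl y) (fun i y => Sum.inr ⟨i, y⟩) q.1 q.2,
      fun q => Sum.elim (fun y => ⟨0, y⟩) (fun y => ⟨y.1.succ, y.2⟩) q, ?_, ?_⟩
    · rintro ⟨i, y⟩
      induction i using Fin.cases <;> rfl
    · rintro (y | ⟨i, y⟩) <;> rfl

lemma aux_crt {K L Γ₀ : Type*} [Field K] [Field L] [Algebra K L] [FiniteDimensional K L]
    [LinearOrderedCommGroupWithZero Γ₀] (v : Valuation K Γ₀)
    {n : ℕ} (W : Fin n → ValuationSubring L)
    (hW : ∀ i, (W i).comap (algebraMap K L) = v.valuationSubring)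
    (hdist : ∀ i j, i ≠ j → W i ≠ W j) (i : Fin n) (b : IsLocalRing.ResidueField (W i)) :
    ∃ x : L, ∃ hx : ∀ j, x ∈ W j, IsLocalRing.residue (W i) ⟨x, hx i⟩ = b ∧
      ∀ j, j ≠ i → IsLocalRing.residue (W j) ⟨x, hx j⟩ = 0 := by
  classical
  let R : Subring L := ⨅ j, (W j).toSubring
  have hR : ∀ x : L, x ∈ R ↔ ∀ j, x ∈ W j := fun x => by
    simp [R, Subring.mem_iInf]
  let f : (j : Fin n) → R →+* IsLocalRing.ResidueField (W j) := fun j =>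
    (IsLocalRing.residue (W j)).comp
      (Subring.inclusion (iInf_le (fun j => (W j).toSubring) j))
  have hf : ∀ j (x : R), f j x = IsLocalRing.residue (W j) ⟨x, (hR x).1 x.2 j⟩ := fun j x => rfl
  have hsurj : ∀ j, Function.Surjective (f j) := by
    intro j y
    obtain ⟨⟨a, ha⟩, rfl⟩ := IsLocalRing.residue_surjective y
    obtain ⟨u, w, huw, H⟩ := aux_key v a
    refine ⟨⟨w, (hR w).2 fun k => (H (W k) (hW k)).2.1⟩, ?_⟩
    rw [hf, ← sub_eq_zero, ← map_sub, aux_res]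
    have e : ((⟨w, (H (W j) (hW j)).2.1⟩ - ⟨a, ha⟩ : W j) : L) = (u - 1) * a := by
      simp [← huw, sub_mul]
    rw [e, map_mul]
    exact mul_lt_one_of_lt_of_le ((H (W j) (hW j)).2.2 ha) (((W j).valuation_le_one_iff _).2 ha)
  have hmax : ∀ j, (RingHom.ker (f j)).IsMaximal := fun j =>
    RingHom.ker_isMaximal_of_surjective (f j) (hsurj j)
  have hle : ∀ j k, RingHom.ker (f j) = RingHom.ker (f k) → W j ≤ W k := by
    intro j k hjk a ha
    obtain ⟨u, w, huw, H⟩ := aux_key v a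
    have huR : u ∈ R := (hR u).2 fun k => (H (W k) (hW k)).1
    have h1 : (W j).valuation u = 1 := by
      have := (H (W j) (hW j)).2.2 ha
      have h2 := Valuation.map_one_add_of_lt _ this
      rwa [add_sub_cancel] at h2
    have h2 : (⟨u, huR⟩ : R) ∉ RingHom.ker (f j) := by
      rw [RingHom.mem_ker, hf, aux_res]
      exact h1.not_lt
    rw [hjk, RingHom.mem_ker, hf, aux_res] at h2
    have h3 : (W k).valuation u = 1 :=
      le_antisymm (((W k).valuation_le_one_iff _).2 (H (W k) (hW k)).1) (not_lt.1 h2)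
    rw [← ValuationSubring.valuation_le_one_iff]
    have h4 := ((W k).valuation_le_one_iff _).2 (H (W k) (hW k)).2.1
    rwa [← huw, map_mul, h3, one_mul] at h4
  have hcop : Pairwise (Function.onFun IsCoprime fun j => RingHom.ker (f j)) := by
    intro j k hjk
    have := hmax j
    have := hmax k
    exact Ideal.isCoprime_of_isMaximal fun h =>
      hdist j k hjk (le_antisymm (hle j k h) (hle k j h.symm))
  obtain ⟨y, hy⟩ := hsurj i b
  obtain ⟨r, hr⟩ := Ideal.exists_forall_sub_mem_ideal hcop (fun j => if j = i then y else 0)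
  refine ⟨r, (hR r).1 r.2, ?_, ?_⟩
  · have := hr i
    rw [if_pos rfl, RingHom.mem_ker, map_sub, sub_eq_zero, hy] at this
    exact this
  · intro j hj
    have := hr j
    rw [if_neg hj, RingHom.mem_ker, sub_zero] at this
    exact this

/-- Let `v` be a valuation on a field `K`, `L` a finite extension of `K`, and `w₁, …, w_n`
pairwise distinct extensions of `v` to `L` (identified with their valuation rings).  Then the
sum of the residue degrees satisfies `∑ i, [κ_{wᵢ} : κ_v] ≤ [L : K]`, where `κ_{wᵢ}` is a
`κ_v`-vector space via the canonical map `φ i : κ_v → κ_{wᵢ}`. -/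
theorem sum_residue_degrees_le_rank
    {K L Γ₀ : Type*} [Field K] [Field L] [Algebra K L] [FiniteDimensional K L]
    [LinearOrderedCommGroupWithZero Γ₀] (v : Valuation K Γ₀)
    {n : ℕ} (W : Fin n → ValuationSubring L)
    (hW : ∀ i, (W i).comap (algebraMap K L) = v.valuationSubring)
    (hdist : ∀ i j, i ≠ j → W i ≠ W j)
    (hmem : ∀ (i) (y : K), y ∈ v.valuationSubring → algebraMap K L y ∈ W i)
    (φ : (i : Fin n) →
      (IsLocalRing.ResidueField v.valuationSubring →+* IsLocalRing.ResidueField (W i)))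
    (hφ : ∀ (i : Fin n) (x : v.valuationSubring),
      φ i (IsLocalRing.residue v.valuationSubring x)
        = IsLocalRing.residue (W i) ⟨algebraMap K L x, hmem i x x.2⟩) :
    ∑ i : Fin n,
        @Module.rank (IsLocalRing.ResidueField v.valuationSubring)
          (IsLocalRing.ResidueField (W i)) _ _ (φ i).toModule
      ≤ Module.rank K L := by
  classical
  let inst : ∀ i, Module (IsLocalRing.ResidueField v.valuationSubring)
    (IsLocalRing.ResidueField (W i)) := fun i => (φ i).toModule
  have hsm : ∀ i (r : IsLocalRing.ResidueField v.valuationSubring)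
    (x : IsLocalRing.ResidueField (W i)), r • x = φ i r * x := fun i r x => rfl
  let B := fun i => Module.Basis.ofVectorSpace (IsLocalRing.ResidueField v.valuationSubring)
    (IsLocalRing.ResidueField (W i))
  choose x hx hx1 hx2 using fun (q : Σ i, Module.Basis.ofVectorSpaceIndex
    (IsLocalRing.ResidueField v.valuationSubring) (IsLocalRing.ResidueField (W i))) =>
    aux_crt v W hW hdist q.1 (B q.1 q.2)
  have hli : LinearIndependent K x := by
    rw [linearIndependent_iff']
    intro s g hg
    by_contra! hne
    obtain ⟨q0, hq0, hgq0⟩ := hne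
    obtain ⟨⟨i, b⟩, hqs, hmax⟩ := Finset.exists_max_image s (fun q => v (g q)) ⟨q0, hq0⟩
    have hv0 : v (g ⟨i, b⟩) ≠ 0 := by
      intro h
      have := hmax q0 hq0
      rw [h, le_zero_iff, Valuation.zero_iff] at this
      exact hgq0 this
    have hg0 : g ⟨i, b⟩ ≠ 0 := (Valuation.ne_zero_iff v).1 hv0
    set h : (Σ i, Module.Basis.ofVectorSpaceIndex
      (IsLocalRing.ResidueField v.valuationSubring) (IsLocalRing.ResidueField (W i))) → K :=
      fun q => if q ∈ s then g q / g ⟨i, b⟩ else 0 with hh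
    have hO : ∀ q, h q ∈ v.valuationSubring := by
      intro q
      rw [Valuation.mem_valuationSubring_iff]
      simp only [hh]
      split_ifs with hq
      · rw [map_div₀]
        exact div_le_one_of_le₀ (hmax q hq) zero_le
      · simp
    have hsum : ∑ q ∈ s, algebraMap K L (h q) * x q = 0 := by
      have : ∑ q ∈ s, algebraMap K L (h q) * x q = (g ⟨i, b⟩)⁻¹ • ∑ q ∈ s, g q • x q := by
        rw [Finset.smul_sum]
        refine Finset.sum_congr rfl fun q hq => ?_
        simp only [hh, if_pos hq]
        rw [smul_smul, Algebra.smul_def, div_eq_inv_mul]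
      rw [this, hg, smul_zero]
    have hsumW : ∑ q ∈ s, (⟨algebraMap K L (h q), hmem i _ (hO q)⟩ * ⟨x q, hx q i⟩ : W i) = 0 := by
      apply Subtype.ext
      push_cast
      exact hsum
    have hres := congrArg (IsLocalRing.residue (W i)) hsumW
    rw [map_sum, map_zero] at hres
    have hoff : ∀ q ∈ s, q ∉ Set.range (Sigma.mk i) → IsLocalRing.residue (W i)
        (⟨algebraMap K L (h q), hmem i _ (hO q)⟩ * ⟨x q, hx q i⟩ : W i) = 0 := by
      rintro ⟨k, y⟩ _ hk
      have hki : i ≠ k := by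
        rintro rfl
        exact hk ⟨y, rfl⟩
      rw [map_mul, hx2 ⟨k, y⟩ i hki, mul_zero]
    have hpre := Finset.sum_preimage (Sigma.mk i) s sigma_mk_injective.injOn _ hoff
    rw [hres] at hpre
    have hz : ∑ k ∈ s.preimage (Sigma.mk i) sigma_mk_injective.injOn,
        IsLocalRing.residue v.valuationSubring ⟨h ⟨i, k⟩, hO _⟩ • B i k = 0 := by
      refine Eq.trans ?_ hpre
      refine Finset.sum_congr rfl fun k _ => ?_
      rw [hsm, hφ, map_mul]
      exact congrArg _ (hx1 ⟨i, k⟩).symm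
    have hB := linearIndependent_iff'.1 (B i).linearIndependent _
      (fun k => IsLocalRing.residue v.valuationSubring ⟨h ⟨i, k⟩, hO _⟩) hz b
      (Finset.mem_preimage.2 hqs)
    have h1 : (⟨h ⟨i, b⟩, hO _⟩ : v.valuationSubring) = 1 := by
      apply Subtype.ext
      simp only [hh, if_pos hqs]
      exact div_self hg0
    rw [h1, map_one] at hB
    exact one_ne_zero hB
  have hcard := hli.cardinal_le_rank
  rw [aux_card] at hcard
  refine le_trans (le_of_eq ?_) hcard
  exact Finset.sum_congr rfl fun i _ => (B i).mk_eq_rank''.symm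
end

section
/- Let v be a valuation on a field K, L a finite extension of K, and w an extension of v to L. Let a_1, …, a_n ∈ O_w with w(a_1) = … = w(a_n) = 0 whose residues in κ_w are linearly independent over κ_v, and let b_1, …, b_m ∈ L\{0} with w(b_1), …, w(b_m) lying in pairwise distinct cosets of Γ_v in Γ_w. Then for all c_{i,j} ∈ K (1 ≤ i ≤ n, 1 ≤ j ≤ m), w(Σ_{i,j} c_{i,j} a_i b_j) = min{ w(c_{i,j} a_i b_j) : 1 ≤ i ≤ n, 1 ≤ j ≤ m }. In particular the n·m elements a_i b_j are linearly independent over K. -/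
/-- Sums of unit-valued elements with residues linearly independent. -/
theorem aux_val_sum
    {K L Γ₀ : Type*} [Field K] [Field L] [Algebra K L]
    [LinearOrderedCommGroupWithZero Γ₀]
    (v : Valuation K Γ₀) (w : Valuation L Γ₀)
    (hw : ∀ x, w (algebraMap K L x) = v x)
    (hmem : ∀ y : K, y ∈ v.valuationSubring → algebraMap K L y ∈ w.valuationSubring)
    (φ : IsLocalRing.ResidueField v.valuationSubring →+*
      IsLocalRing.ResidueField w.valuationSubring)
    (hφ : ∀ x : v.valuationSubring,
      φ (IsLocalRing.residue v.valuationSubring x)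
        = IsLocalRing.residue w.valuationSubring ⟨algebraMap K L x, hmem x x.2⟩)
    {n : ℕ}
    (a : Fin n → L) (hamem : ∀ i, a i ∈ w.valuationSubring)
    (hind : @LinearIndependent (Fin n) (IsLocalRing.ResidueField v.valuationSubring)
      (IsLocalRing.ResidueField w.valuationSubring)
      (fun i => IsLocalRing.residue w.valuationSubring ⟨a i, hamem i⟩) _ _ φ.toModule)
    (d : Fin n → K) (k : Fin n) (hk : ∀ i, v (d i) ≤ v (d k)) :
    w (∑ i, algebraMap K L (d i) * a i) = v (d k) := by
  by_cases h0 : d k = 0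
  · have : ∀ i, d i = 0 := fun i => by
      have := hk i
      rw [h0, map_zero, le_zero_iff, map_eq_zero] at this
      exact this
    simp [this]
  have hv0 : v (d k) ≠ 0 := (map_ne_zero v).2 h0
  have he : ∀ i, d i / d k ∈ v.valuationSubring := fun i => by
    rw [Valuation.mem_valuationSubring_iff, map_div₀]
    exact div_le_one_of_le₀ (hk i) zero_le
  letI := φ.toModule
  rw [Fintype.linearIndependent_iff] at hind
  let S : w.valuationSubring := ∑ i, ⟨algebraMap K L (d i / d k), hmem _ (he i)⟩ * ⟨a i, hamem i⟩
  have hS : IsLocalRing.residue w.valuationSubring S ≠ 0 := by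
    intro h
    have h1 := hind (fun i => IsLocalRing.residue v.valuationSubring ⟨d i / d k, he i⟩) (by
      rw [← h, map_sum]
      refine Finset.sum_congr rfl fun i _ => ?_
      rw [map_mul, ← hφ ⟨d i / d k, he i⟩]
      rfl) k
    have h2 : (⟨d k / d k, he k⟩ : v.valuationSubring) = 1 := Subtype.ext (div_self h0)
    rw [h2, map_one] at h1
    exact one_ne_zero h1
  have hU : IsUnit S := (IsLocalRing.residue_ne_zero_iff_isUnit S).1 hS
  have hSv : w (S : L) = 1 := by
    obtain ⟨T, hT⟩ := hU.exists_right_inv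
    have h1 : w (S : L) * w (T : L) = 1 := by
      rw [← map_mul, ← w.map_one]
      exact congrArg (fun x : w.valuationSubring => w (x : L)) hT
    have hS1 : w (S : L) ≤ 1 := S.2
    have hT1 : w (T : L) ≤ 1 := T.2
    refine le_antisymm hS1 ?_
    calc 1 = w (S : L) * w (T : L) := h1.symm
      _ ≤ w (S : L) * 1 := by gcongr
      _ = _ := mul_one _
  have hsum : ∑ i, algebraMap K L (d i) * a i = algebraMap K L (d k) * (S : L) := by
    simp only [S, AddSubmonoidClass.coe_finset_sum, Finset.mul_sum]
    refine Finset.sum_congr rfl fun i _ => ?_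
    change _ = algebraMap K L (d k) * (algebraMap K L (d i / d k) * a i)
    rw [← mul_assoc, ← map_mul, mul_div_cancel₀ _ h0]
  rw [hsum, map_mul, hSv, mul_one, hw]

/-- Let `v` be a valuation on a field `K`, `L` a finite extension of `K`, and `w` an extension
of `v` to `L`.  Let `a₁, …, a_n ∈ 𝒪_w` with `w(aᵢ) = 1` (i.e. additive value `0`) whose residues
in `κ_w` are linearly independent over `κ_v`, and let `b₁, …, b_m ∈ L \ {0}` with
`w(b₁), …, w(b_m)` in pairwise distinct cosets of `Γ_v` in `Γ_w`.  Then for all `c i j ∈ K`,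
the additive value of `∑ i j, c i j * aᵢ * b j` is the minimum of the additive values of the
terms `c i j * aᵢ * b j`; with Mathlib's multiplicative convention this minimum becomes the
maximum (`Finset.sup'`) of the values `w (c i j * aᵢ * b j)`.  In particular the `n·m`
elements `aᵢ * b j` are linearly independent over `K`. -/
theorem valuation_of_sum_eq_min_and_linearIndependent
    {K L Γ₀ : Type*} [Field K] [Field L] [Algebra K L] [FiniteDimensional K L]
    [LinearOrderedCommGroupWithZero Γ₀]
    (v : Valuation K Γ₀) (w : Valuation L Γ₀)
    (hw : w.comap (algebraMap K L) = v)
    (hmem : ∀ y : K, y ∈ v.valuationSubring → algebraMap K L y ∈ w.valuationSubring)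
    (φ : IsLocalRing.ResidueField v.valuationSubring →+*
      IsLocalRing.ResidueField w.valuationSubring)
    (hφ : ∀ x : v.valuationSubring,
      φ (IsLocalRing.residue v.valuationSubring x)
        = IsLocalRing.residue w.valuationSubring ⟨algebraMap K L x, hmem x x.2⟩)
    {n m : ℕ} [NeZero n] [NeZero m]
    (a : Fin n → L) (ha : ∀ i, w (a i) = 1) (hamem : ∀ i, a i ∈ w.valuationSubring)
    (hind : @LinearIndependent (Fin n) (IsLocalRing.ResidueField v.valuationSubring)
      (IsLocalRing.ResidueField w.valuationSubring)
      (fun i => IsLocalRing.residue w.valuationSubring ⟨a i, hamem i⟩) _ _ φ.toModule)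
    (b : Fin m → L) (hb : ∀ j, b j ≠ 0)
    (hcoset : ∀ j k : Fin m, j ≠ k → ¬∃ y : K, y ≠ 0 ∧ w (b j) = v y * w (b k)) :
    (∀ c : Fin n → Fin m → K,
      w (∑ i : Fin n, ∑ j : Fin m, algebraMap K L (c i j) * a i * b j)
        = Finset.univ.sup' Finset.univ_nonempty
            (fun p : Fin n × Fin m => w (algebraMap K L (c p.1 p.2) * a p.1 * b p.2))) ∧
    LinearIndependent K (fun p : Fin n × Fin m => a p.1 * b p.2) := by
  have hw' : ∀ x, w (algebraMap K L x) = v x := fun x => by rw [← hw]; rfl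
  have main : ∀ c : Fin n → Fin m → K,
      w (∑ i : Fin n, ∑ j : Fin m, algebraMap K L (c i j) * a i * b j)
        = Finset.univ.sup' Finset.univ_nonempty
            (fun p : Fin n × Fin m => w (algebraMap K L (c p.1 p.2) * a p.1 * b p.2)) := by
    intro c
    have hterm : ∀ i j, w (algebraMap K L (c i j) * a i * b j) = v (c i j) * w (b j) := by
      intro i j
      rw [map_mul, map_mul, ha, mul_one, hw']
    obtain ⟨⟨i₀, j₀⟩, -, hmax⟩ := Finset.exists_max_image (Finset.univ : Finset (Fin n × Fin m))
      (fun p => w (algebraMap K L (c p.1 p.2) * a p.1 * b p.2)) Finset.univ_nonempty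
    have hsup : Finset.univ.sup' Finset.univ_nonempty
        (fun p : Fin n × Fin m => w (algebraMap K L (c p.1 p.2) * a p.1 * b p.2))
        = v (c i₀ j₀) * w (b j₀) := by
      rw [← hterm]
      refine le_antisymm (Finset.sup'_le _ _ hmax) ?_
      exact Finset.le_sup' (fun p : Fin n × Fin m =>
        w (algebraMap K L (c p.1 p.2) * a p.1 * b p.2)) (Finset.mem_univ (i₀, j₀))
    have hmax' : ∀ i j, v (c i j) * w (b j) ≤ v (c i₀ j₀) * w (b j₀) := by
      intro i j
      rw [← hterm, ← hterm]
      exact hmax (i, j) (Finset.mem_univ _)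
    rw [hsup]
    have hwb : ∀ j, w (b j) ≠ 0 := fun j => (map_ne_zero w).2 (hb j)
    by_cases h0 : c i₀ j₀ = 0
    · have hz : ∀ i j, c i j = 0 := by
        intro i j
        have := hmax' i j
        rw [h0, map_zero, zero_mul, le_zero_iff] at this
        exact (map_eq_zero v).1 ((mul_eq_zero.1 this).resolve_right (hwb j))
      simp [hz]
    have hpos : v (c i₀ j₀) * w (b j₀) ≠ 0 := mul_ne_zero ((map_ne_zero v).2 h0) (hwb j₀)
    -- for each column, the value
    have hcol : w ((∑ i, algebraMap K L (c i j₀) * a i) * b j₀) = v (c i₀ j₀) * w (b j₀) := by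
      rw [map_mul, aux_val_sum v w hw' hmem φ hφ a hamem hind (fun i => c i j₀) i₀]
      intro i
      exact le_of_mul_le_mul_right (hmax' i j₀) (zero_lt_iff.2 (hwb j₀))
    have hlt : ∀ j ≠ j₀, ∀ i, v (c i j) * w (b j) < v (c i₀ j₀) * w (b j₀) := by
      intro j hj i
      refine lt_of_le_of_ne (hmax' i j) fun heq => ?_
      have hc : c i j ≠ 0 := by
        intro hc
        rw [hc, map_zero, zero_mul] at heq
        exact hpos heq.symm
      refine hcoset j j₀ hj ⟨c i₀ j₀ / c i j, div_ne_zero h0 hc, ?_⟩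
      have hvc : v (c i j) ≠ 0 := (map_ne_zero v).2 hc
      rw [map_div₀, div_mul_eq_mul_div, ← heq, mul_div_cancel_left₀ _ hvc]
    have hrest : w (∑ j ∈ Finset.univ.erase j₀, ∑ i, algebraMap K L (c i j) * a i * b j)
        < v (c i₀ j₀) * w (b j₀) := by
      refine w.map_sum_lt hpos fun j hj => w.map_sum_lt hpos fun i _ => ?_
      rw [hterm]
      exact hlt j (Finset.ne_of_mem_erase hj) i
    rw [Finset.sum_comm, ← Finset.add_sum_erase _ _ (Finset.mem_univ j₀), ← Finset.sum_mul]
    rw [← hcol] at hrest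
    rw [Valuation.map_add_eq_of_lt_left _ hrest, hcol]
  refine ⟨main, ?_⟩
  rw [Fintype.linearIndependent_iff]
  intro g hg p
  have h := main (fun i j => g (i, j))
  have hs : ∑ i : Fin n, ∑ j : Fin m, algebraMap K L (g (i, j)) * a i * b j = 0 := by
    rw [← hg, Fintype.sum_prod_type]
    simp only [Algebra.smul_def, mul_assoc]
  rw [hs, map_zero] at h
  have hle := Finset.le_sup' (fun p : Fin n × Fin m =>
        w (algebraMap K L (g (p.1, p.2)) * a p.1 * b p.2)) (Finset.mem_univ p)
  rw [← h, le_zero_iff, map_mul, map_mul, ha, mul_one, hw'] at hle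
  exact (map_eq_zero v).1 ((mul_eq_zero.1 hle).resolve_right ((map_ne_zero w).2 (hb _)))
end

section
/- Let v be a valuation on a field K, L a finite extension of K, and w an extension of v to L. Then the product of the ramification index and residue degree satisfies e(w|v)·f(w|v) ≤ [L : K], where e(w|v) = [Γ_w : Γ_v] and f(w|v) = [κ_w : κ_v]. -/
/-- The value group of a valuation on a field `F`: the subgroup of `Γ₀ˣ` consisting of the
values of the nonzero elements of `F`. -/
def Valuation.valueGroup {F Γ₀ : Type*} [Field F] [LinearOrderedCommGroupWithZero Γ₀]
    (v : Valuation F Γ₀) : Subgroup Γ₀ˣ :=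
  (Units.map v.toMonoidWithZeroHom.toMonoidHom).range

theorem aux_unit_comb
    {K L Γ₀ : Type u} [Field K] [Field L] [Algebra K L]
    [LinearOrderedCommGroupWithZero Γ₀]
    (v : Valuation K Γ₀) (w : Valuation L Γ₀)
    (hw : w.comap (algebraMap K L) = v)
    (hmem : ∀ y : K, y ∈ v.valuationSubring → algebraMap K L y ∈ w.valuationSubring)
    (φ : IsLocalRing.ResidueField v.valuationSubring →+*
      IsLocalRing.ResidueField w.valuationSubring)
    (hφ : ∀ x : v.valuationSubring,
      φ (IsLocalRing.residue v.valuationSubring x)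
        = IsLocalRing.residue w.valuationSubring ⟨algebraMap K L x, hmem x x.2⟩)
    {B : Type u} (b : B → w.valuationSubring)
    (hb : @LinearIndependent B (IsLocalRing.ResidueField v.valuationSubring)
      (IsLocalRing.ResidueField w.valuationSubring)
      (fun j => IsLocalRing.residue w.valuationSubring (b j)) _ _ φ.toModule)
    (s : Finset B) (c : B → K) (hc : ∃ j ∈ s, c j ≠ 0) :
    ∃ k : K, k ≠ 0 ∧ w (∑ j ∈ s, algebraMap K L (c j) * (b j : L)) = v k := by
  classical
  letI := φ.toModule
  have hv : ∀ x, w (algebraMap K L x) = v x := fun x => by rw [← hw]; rfl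
  obtain ⟨j1, hj1, hj1c⟩ := hc
  obtain ⟨j0, hj0, hmax⟩ := s.exists_max_image (fun j => v (c j)) ⟨j1, hj1⟩
  have hc0 : c j0 ≠ 0 := by
    intro h
    have := hmax j1 hj1
    simp [h] at this
    exact hj1c this
  refine ⟨c j0, hc0, ?_⟩
  have hv0 : v (c j0) ≠ 0 := (v.ne_zero_iff).2 hc0
  have hd : ∀ j, j ∈ s → c j / c j0 ∈ v.valuationSubring := by
    intro j hj
    rw [Valuation.mem_valuationSubring_iff, map_div₀]
    exact div_le_one_of_le₀ (hmax j hj) zero_le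
  let d : B → v.valuationSubring := fun j => if h : j ∈ s then ⟨c j / c j0, hd j h⟩ else 0
  have hds : ∀ j ∈ s, (d j : K) = c j / c j0 := fun j hj => by simp [d, hj]
  let t : w.valuationSubring := ∑ j ∈ s, ⟨algebraMap K L (d j), hmem _ (d j).2⟩ * b j
  have hres : IsLocalRing.residue w.valuationSubring t ≠ 0 := by
    intro h
    have h2 : ∑ j ∈ s, (IsLocalRing.residue v.valuationSubring (d j)) •
        IsLocalRing.residue w.valuationSubring (b j) = 0 := by
      rw [← h, map_sum]
      refine Finset.sum_congr rfl fun j _ => ?_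
      rw [map_mul, ← hφ]
      rfl
    have h3 := linearIndependent_iff'.1 hb s _ h2 j0 hj0
    have h4 : d j0 = 1 := Subtype.ext (by rw [hds j0 hj0, div_self hc0]; rfl)
    rw [h4, map_one] at h3
    exact one_ne_zero h3
  have ht1 : w (t : L) = 1 := by
    rw [IsLocalRing.residue_ne_zero_iff_isUnit] at hres
    have := (w.valuationSubring.valuation_eq_one_iff t).1 hres
    exact (Valuation.isEquiv_iff_val_eq_one.1 w.isEquiv_valuation_valuationSubring).2 this
  have hsum : ∑ j ∈ s, algebraMap K L (c j) * (b j : L) = algebraMap K L (c j0) * (t : L) := by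
    have : (t : L) = ∑ j ∈ s, algebraMap K L (d j) * (b j : L) := by
      simp [t]
    rw [this, Finset.mul_sum]
    refine Finset.sum_congr rfl fun j hj => ?_
    rw [hds j hj, ← mul_assoc, ← map_mul, mul_div_cancel₀ _ hc0]
  rw [hsum, map_mul, ht1, mul_one, hv]

theorem aux_sum_ne_zero {L Γ₀ I : Type*} [Field L] [LinearOrderedCommGroupWithZero Γ₀]
    (w : Valuation L Γ₀) (s : Finset I) (x : I → L) (hx : ∃ i ∈ s, x i ≠ 0)
    (hinj : ∀ i ∈ s, ∀ j ∈ s, x i ≠ 0 → x j ≠ 0 → w (x i) = w (x j) → i = j) :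
    ∑ i ∈ s, x i ≠ 0 := by
  classical
  obtain ⟨i1, hi1, hx1⟩ := hx
  obtain ⟨i0, hi0, hmax⟩ := s.exists_max_image (fun j => w (x j)) ⟨i1, hi1⟩
  have h0 : x i0 ≠ 0 := by
    intro h
    have := hmax i1 hi1
    simp [h] at this
    exact hx1 this
  have hw0 : w (x i0) ≠ 0 := w.ne_zero_iff.2 h0
  have hlt : w (∑ i ∈ s.erase i0, x i) < w (x i0) := by
    refine w.map_sum_lt hw0 fun i hi => ?_
    have his := Finset.mem_of_mem_erase hi
    refine lt_of_le_of_ne (hmax i his) fun h => ?_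
    have hxi : x i ≠ 0 := by
      intro h'
      rw [h', map_zero] at h
      exact hw0 h.symm
    exact Finset.ne_of_mem_erase hi (hinj i his i0 hi0 hxi h0 h)
  intro hs
  rw [← Finset.add_sum_erase s x hi0] at hs
  have := w.map_add_eq_of_lt_left hlt
  rw [hs, map_zero] at this
  exact hw0 this.symm

/-- Let `v` be a valuation on a field `K`, `L` a finite extension of `K`, and `w` an extension
of `v` to `L`.  Then the product of the ramification index `e(w|v) = [Γ_w : Γ_v]` (the
cardinality of the coset space `Γ_w/Γ_v`) with the residue degree `f(w|v) = [κ_w : κ_v]`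
satisfies `e(w|v)·f(w|v) ≤ [L : K]`. -/
theorem ramification_index_mul_residue_degree_le_rank
    {K L Γ₀ : Type u} [Field K] [Field L] [Algebra K L] [FiniteDimensional K L]
    [LinearOrderedCommGroupWithZero Γ₀]
    (v : Valuation K Γ₀) (w : Valuation L Γ₀)
    (hw : w.comap (algebraMap K L) = v)
    (hmem : ∀ y : K, y ∈ v.valuationSubring → algebraMap K L y ∈ w.valuationSubring)
    (φ : IsLocalRing.ResidueField v.valuationSubring →+*
      IsLocalRing.ResidueField w.valuationSubring)
    (hφ : ∀ x : v.valuationSubring,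
      φ (IsLocalRing.residue v.valuationSubring x)
        = IsLocalRing.residue w.valuationSubring ⟨algebraMap K L x, hmem x x.2⟩) :
    Cardinal.mk (w.valueGroup ⧸ v.valueGroup.subgroupOf w.valueGroup)
        * @Module.rank (IsLocalRing.ResidueField v.valuationSubring)
            (IsLocalRing.ResidueField w.valuationSubring) _ _ φ.toModule
      ≤ Module.rank K L := by
  classical
  letI := φ.toModule
  have hv : ∀ x, w (algebraMap K L x) = v x := fun x => by rw [← hw]; rfl
  let bas := Module.Free.chooseBasis (IsLocalRing.ResidueField v.valuationSubring)
    (IsLocalRing.ResidueField w.valuationSubring)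
  let B := Module.Free.ChooseBasisIndex (IsLocalRing.ResidueField v.valuationSubring)
    (IsLocalRing.ResidueField w.valuationSubring)
  let I := w.valueGroup ⧸ v.valueGroup.subgroupOf w.valueGroup
  choose b hb using fun j : B => IsLocalRing.residue_surjective (R := w.valuationSubring) (bas j)
  have hbl : LinearIndependent (IsLocalRing.ResidueField v.valuationSubring)
      (fun j => IsLocalRing.residue w.valuationSubring (b j)) := by
    have : (fun j => IsLocalRing.residue w.valuationSubring (b j)) = bas := funext hb
    rw [this]
    exact bas.linearIndependent
  have hrep : ∀ i : I, ∃ p : Lˣ, ∃ g : w.valueGroup,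
      (QuotientGroup.mk g : I) = i ∧ (((g : Γ₀ˣ) : Γ₀)) = w (p : L) := by
    intro i
    obtain ⟨⟨g, p, hp⟩, rfl⟩ := QuotientGroup.mk_surjective i
    exact ⟨p, ⟨g, p, hp⟩, rfl, (congrArg Units.val hp).symm⟩
  choose p g hg hp using hrep
  have key := aux_unit_comb v w hw hmem φ hφ b hbl
  have hlin : LinearIndependent K (fun q : I × B => (p q.1 : L) * (b q.2 : L)) := by
    rw [linearIndependent_iff'']
    intro s c hcs hsum
    by_contra! hne
    obtain ⟨⟨i1, j1⟩, hne⟩ := hne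
    have hmem1 : (i1, j1) ∈ s := by
      by_contra h
      exact hne (hcs _ h)
    set S := s.image Prod.fst
    set T := s.image Prod.snd
    have hi1 : i1 ∈ S := Finset.mem_image.2 ⟨_, hmem1, rfl⟩
    have hj1 : j1 ∈ T := Finset.mem_image.2 ⟨_, hmem1, rfl⟩
    have hsub : s ⊆ S ×ˢ T := Finset.subset_product
    let y : I → L := fun i => ∑ j ∈ T, algebraMap K L (c (i, j)) * (b j : L)
    have hy : ∀ i, y i ≠ 0 → ∃ k : K, k ≠ 0 ∧ w (y i) = v k := by
      intro i hi
      apply key T (fun j => c (i, j))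
      by_contra! h
      exact hi (Finset.sum_eq_zero fun j hj => by rw [h j hj]; simp)
    have htot : ∑ i ∈ S, (p i : L) * y i = 0 := by
      rw [← hsum, Finset.sum_subset hsub (fun q _ hq => by rw [hcs q hq, zero_smul]),
        Finset.sum_product]
      refine Finset.sum_congr rfl fun i _ => ?_
      rw [Finset.mul_sum]
      refine Finset.sum_congr rfl fun j _ => ?_
      rw [Algebra.smul_def]
      ring
    refine aux_sum_ne_zero w S (fun i => (p i : L) * y i) ⟨i1, hi1, ?_⟩ ?_ htot
    · obtain ⟨k, hk, hk2⟩ := key T (fun j => c (i1, j)) ⟨j1, hj1, hne⟩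
      refine mul_ne_zero (p i1).ne_zero ?_
      rw [← w.ne_zero_iff]
      change w (∑ j ∈ T, algebraMap K L (c (i1, j)) * (b j : L)) ≠ 0
      rw [hk2]
      exact v.ne_zero_iff.2 hk
    · intro i _ j _ hi hj hij
      obtain ⟨k, hk, hki⟩ := hy i (right_ne_zero_of_mul hi)
      obtain ⟨l, hl, hlj⟩ := hy j (right_ne_zero_of_mul hj)
      rw [map_mul, map_mul, hki, hlj, ← hp, ← hp] at hij
      rw [← hg i, ← hg j, QuotientGroup.eq, Subgroup.mem_subgroupOf]
      refine ⟨Units.mk0 k hk * (Units.mk0 l hl)⁻¹, ?_⟩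
      rw [map_mul, map_inv, mul_inv_eq_iff_eq_mul]
      change _ = ((g i : Γ₀ˣ)⁻¹ * (g j : Γ₀ˣ)) * _
      rw [mul_assoc, eq_inv_mul_iff_mul_eq]
      exact Units.ext hij
  have hcard := hlin.cardinal_le_rank
  rw [← Cardinal.mul_def] at hcard
  rwa [Module.Free.rank_eq_card_chooseBasisIndex]
end

section
/- Let v be a valuation on a field K, L a finite extension of K, and w_1, …, w_n pairwise distinct extensions of v to L, with value groups viewed inside the divisible closure of Γ_v. Then for every γ ∈ Γ_{w_1} there exists x ∈ L with w_1(x) = γ and w_i(x) > γ for all i > 1. -/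
open Polynomial in
theorem aux_aeval_le {L Γ₀ : Type*} [Field L] [LinearOrderedCommGroupWithZero Γ₀]
    (w : Valuation L Γ₀) (y : L) (hy : w y ≤ 1) (h : ℤ[X]) : w (aeval y h) ≤ 1 := by
  rw [aeval_eq_sum_range]
  refine w.map_sum_le fun i _ => ?_
  rw [zsmul_eq_mul, map_mul, map_pow]
  have h1 : w ((h.coeff i : ℤ) : L) ≤ 1 := intCast_mem w.integer (h.coeff i)
  exact mul_le_one' h1 (pow_le_one' hy i)

open Polynomial in
theorem aux_aeval_eq {L Γ₀ : Type*} [Field L] [LinearOrderedCommGroupWithZero Γ₀]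
    (w : Valuation L Γ₀) (y : L) (hy : 1 < w y) (h : ℤ[X]) (hm : h.Monic) :
    w (aeval y h) = w y ^ h.natDegree := by
  have h0 : w y ≠ 0 := (zero_lt_one.trans hy).ne'
  rw [aeval_eq_sum_range, Finset.sum_range_succ, hm.coeff_natDegree, one_smul, ← map_pow]
  refine w.map_add_eq_of_lt_right ?_
  rw [map_pow]
  refine w.map_sum_lt (pow_ne_zero _ h0) fun i hi => ?_
  rw [zsmul_eq_mul, map_mul, map_pow]
  have h1 : w ((h.coeff i : ℤ) : L) ≤ 1 := intCast_mem w.integer (h.coeff i)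
  exact mul_lt_of_le_one_of_lt h1 (pow_lt_pow_right₀ hy (Finset.mem_range.1 hi))

open Polynomial in
theorem aux_z {ι L Γ₀ : Type*} [Fintype ι] [Field L] [LinearOrderedCommGroupWithZero Γ₀]
    (w : ι → Valuation L Γ₀) (y : L) :
    ∃ z : L, ∀ i, (w i y ≤ 1 → w i z = 1) ∧ (1 < w i y → w i z ≤ (w i y)⁻¹) := by
  classical
  have hg : ∀ i, ∃ g : ℤ[X], g.Monic ∧
      ((∃ g' : ℤ[X], g'.Monic ∧ w i (aeval y g') < 1) → w i (aeval y g) < 1) := by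
    intro i
    by_cases h : ∃ g' : ℤ[X], g'.Monic ∧ w i (aeval y g') < 1
    · obtain ⟨g, h1, h2⟩ := h
      exact ⟨g, h1, fun _ => h2⟩
    · exact ⟨1, monic_one, fun h' => absurd h' h⟩
  choose g hgm hg using hg
  set p : ℤ[X] := X * ∏ i, g i with hp
  have hprod : (∏ i, g i).Monic := monic_prod_of_monic _ _ fun i _ => hgm i
  have hpm : p.Monic := monic_X.mul hprod
  have hdeg : p.natDegree = 1 + (∏ i, g i).natDegree := by
    rw [hp, monic_X.natDegree_mul hprod, natDegree_X]
  have hlt : (1 : ℤ[X]).degree < p.degree := by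
    apply degree_lt_degree
    rw [natDegree_one]; omega
  have hfm : (p + 1).Monic := hpm.add_of_left hlt
  have hfd : (p + 1).natDegree = p.natDegree := natDegree_add_eq_left_of_degree_lt hlt
  refine ⟨(aeval y (p + 1))⁻¹, fun i => ⟨fun hy => ?_, fun hy => ?_⟩⟩
  · rw [map_inv₀, inv_eq_one]
    by_cases h : ∃ g' : ℤ[X], g'.Monic ∧ w i (aeval y g') < 1
    · have h1 := hg i h
      have h2 : w i (aeval y p) < 1 := by
        rw [hp, ← Finset.mul_prod_erase _ _ (Finset.mem_univ i), mul_left_comm, map_mul, map_mul]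
        exact mul_lt_of_lt_of_le_one h1 (aux_aeval_le _ _ hy _)
      rw [map_add, map_one, add_comm]
      exact (w i).map_one_add_of_lt h2
    · push Not at h
      exact le_antisymm (aux_aeval_le _ _ hy _) (h _ hfm)
  · rw [map_inv₀, aux_aeval_eq _ _ hy _ hfm, hfd]
    have h0 : 0 < w i y := zero_lt_one.trans hy
    apply inv_anti₀ h0
    exact le_self_pow₀ hy.le (by omega)

open Polynomial in
theorem aux_torsion {K L Γ₀ : Type*} [Field K] [Field L] [Algebra K L] [FiniteDimensional K L]
    [LinearOrderedCommGroupWithZero Γ₀] (w : Valuation L Γ₀) (x : L) (hx : x ≠ 0) :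
    ∃ N : ℕ, N ≠ 0 ∧ ∃ c : K, w x ^ N = w (algebraMap K L c) := by
  classical
  obtain ⟨p, hp0, hp⟩ := Algebra.IsAlgebraic.isAlgebraic (R := K) x
  have hwx : w x ≠ 0 := (w.ne_zero_iff).2 hx
  have hK : ∀ c : K, c ≠ 0 → w (algebraMap K L c) ≠ 0 := fun c hc =>
    (w.ne_zero_iff).2 (by simpa using hc)
  set f : ℕ → L := fun i => algebraMap K L (p.coeff i) * x ^ i with hf
  have hf0 : ∀ i ∈ p.support, w (f i) ≠ 0 := by
    intro i hi
    rw [hf, map_mul, map_pow]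
    exact mul_ne_zero (hK _ (mem_support_iff.1 hi)) (pow_ne_zero _ hwx)
  have hsum : ∑ i ∈ p.support, f i = 0 := by
    rw [aeval_def, eval₂_eq_sum, Polynomial.sum] at hp
    exact hp
  obtain ⟨j, hj, hmax⟩ := Finset.exists_max_image p.support (fun i => w (f i))
    (support_nonempty.2 hp0)
  have hex : ∃ i ∈ p.support, i ≠ j ∧ w (f i) = w (f j) := by
    by_contra! hcon
    have := w.map_sum_eq_of_lt (f := f) hj (hf := fun i hi => by
      rw [Finset.mem_sdiff, Finset.mem_singleton] at hi
      exact lt_of_le_of_ne (hmax i hi.1) (hcon i hi.1 hi.2))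
    rw [hsum, map_zero] at this
    exact hf0 j hj this.symm
  obtain ⟨i, hi, hij, he⟩ := hex
  have key : ∀ i j : ℕ, i ∈ p.support → j ∈ p.support → i < j → w (f i) = w (f j) →
      ∃ N : ℕ, N ≠ 0 ∧ ∃ c : K, w x ^ N = w (algebraMap K L c) := by
    intro i j hi hj hlt he
    refine ⟨j - i, by omega, p.coeff i / p.coeff j, ?_⟩
    simp only [hf, map_mul, map_pow] at he
    rw [map_div₀, map_div₀, eq_div_iff (hK _ (mem_support_iff.1 hj))]
    apply mul_right_cancel₀ (pow_ne_zero i hwx)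
    rw [he, mul_right_comm, ← pow_add, Nat.sub_add_cancel hlt.le, mul_comm]
  rcases lt_or_gt_of_ne hij with h | h
  · exact key i j hi hj h he
  · exact key j i hj hi h he.symm

theorem aux_incomp {K L Γ₀ : Type*} [Field K] [Field L] [Algebra K L] [FiniteDimensional K L]
    [LinearOrderedCommGroupWithZero Γ₀] (w w' : Valuation L Γ₀)
    (hw : w.comap (algebraMap K L) = w'.comap (algebraMap K L))
    (hne : w.valuationSubring ≠ w'.valuationSubring) : ∃ c : L, w c ≤ 1 ∧ 1 < w' c := by
  by_contra! hcon
  apply hne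
  ext x
  rw [Valuation.mem_valuationSubring_iff, Valuation.mem_valuationSubring_iff]
  refine ⟨hcon x, fun hx => ?_⟩
  by_contra! h1
  have hx0 : x ≠ 0 := by rintro rfl; simp at h1
  obtain ⟨N, hN, c, hc⟩ := aux_torsion (K := K) w x hx0
  have hcc : w (algebraMap K L c) = w' (algebraMap K L c) := DFunLike.congr_fun hw c
  have h2 : 1 < w x ^ N := one_lt_pow₀ h1 hN
  have h3 := hcon (algebraMap K L c / x ^ N) (by
    rw [map_div₀, map_pow, ← hc, div_self (pow_ne_zero _ ((w.ne_zero_iff).2 hx0))])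
  have hpos : 0 < w' x ^ N := zero_lt_iff.2 (pow_ne_zero _ ((w'.ne_zero_iff).2 hx0))
  rw [map_div₀, map_pow, ← hcc, ← hc, div_le_one₀ hpos] at h3
  exact absurd (h2.trans_le h3) (not_lt.2 (pow_le_one' hx N))


/-- Let `v` be a valuation on a field `K`, `L` a finite extension of `K`, and `w₁, …, w_n`
pairwise distinct extensions of `v` to `L`, their values all taken in a common value group
(e.g. the divisible closure of `Γ_v`).  Then for every `γ ∈ Γ_{w₁}` there exists `x ∈ L` with
`w₁(x) = γ` and `wᵢ(x) > γ` (additively) for all `i > 1`; with Mathlib's multiplicative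
convention the latter reads `wᵢ(x) < γ`. -/
theorem exists_value_eq_and_gt
    {K L Γ₀ : Type*} [Field K] [Field L] [Algebra K L] [FiniteDimensional K L]
    [LinearOrderedCommGroupWithZero Γ₀]
    {n : ℕ} [NeZero n] (v : Valuation K Γ₀) (w : Fin n → Valuation L Γ₀)
    (hw : ∀ i, (w i).comap (algebraMap K L) = v)
    (hdist : ∀ i j, i ≠ j → (w i).valuationSubring ≠ (w j).valuationSubring)
    (γ : Γ₀) (hγ : ∃ x₀ : L, x₀ ≠ 0 ∧ w 0 x₀ = γ) :
    ∃ x : L, w 0 x = γ ∧ ∀ i : Fin n, i ≠ 0 → w i x < γ := by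
  classical
  obtain ⟨x₀, hx0, hγ⟩ := hγ
  have hc : ∀ i, ∃ c : L, i ≠ 0 → w 0 c ≤ 1 ∧ 1 < w i c := by
    intro i
    by_cases h : i = 0
    · exact ⟨0, fun h' => absurd h h'⟩
    · obtain ⟨c, hc⟩ := aux_incomp (K := K) (w 0) (w i) ((hw 0).trans (hw i).symm)
        (hdist 0 i (Ne.symm h))
      exact ⟨c, fun _ => hc⟩
  choose c hc using hc
  choose z hz using fun i => aux_z w (c i)
  have hzle : ∀ i j, w j (z i) ≤ 1 := by
    intro i j
    rcases le_or_gt (w j (c i)) 1 with h | h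
    · exact ((hz i j).1 h).le
    · exact ((hz i j).2 h).trans (inv_le_one_of_one_le₀ h.le)
  set a : L := ∏ i ∈ Finset.univ.erase 0, z i with ha
  have ha0 : w 0 a = 1 := by
    rw [ha, map_prod]
    exact Finset.prod_eq_one fun i hi => (hz i 0).1 (hc i (Finset.ne_of_mem_erase hi)).1
  have hai : ∀ i, i ≠ 0 → w i a < 1 := by
    intro i hi
    rw [ha, ← Finset.mul_prod_erase _ _ (Finset.mem_erase.2 ⟨hi, Finset.mem_univ i⟩), map_mul,
      map_prod]
    refine mul_lt_of_lt_of_le_one ?_ (Finset.prod_le_one' fun j _ => hzle j i)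
    have h := (hc i hi).2
    exact ((hz i i).2 h).trans_lt (inv_lt_one_of_one_lt₀ h)
  obtain ⟨N, hN, d, hd⟩ := aux_torsion (K := K) (w 0) x₀ hx0
  have hdv : ∀ i, w i (algebraMap K L d) = γ ^ N := by
    intro i
    rw [← hγ, hd]
    exact DFunLike.congr_fun ((hw i).trans (hw 0).symm) d
  have hγ0 : γ ≠ 0 := by rw [← hγ]; exact ((w 0).ne_zero_iff).2 hx0
  have hγN : γ ^ N ≠ 0 := pow_ne_zero _ hγ0
  set y : L := x₀ ^ N / algebraMap K L d with hy
  have hyi : ∀ i, w i y = w i x₀ ^ N / γ ^ N := by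
    intro i; rw [hy, map_div₀, map_pow, hdv]
  obtain ⟨t, ht⟩ := aux_z w y
  have hb0 : w 0 t = 1 := (ht 0).1 (by rw [hyi, hγ, div_self hγN])
  refine ⟨x₀ * (a * t), by rw [map_mul, map_mul, ha0, hb0, hγ, mul_one, mul_one], fun i hi => ?_⟩
  have hx : w i x₀ ≠ 0 := ((w i).ne_zero_iff).2 hx0
  have hyne : w i y ≠ 0 := by rw [hyi]; exact div_ne_zero (pow_ne_zero _ hx) hγN
  have hb : w i (a * t) ≤ 1 ∧ w i y * w i (a * t) < 1 := by
    rw [map_mul]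
    rcases le_or_gt (w i y) 1 with h | h
    · rw [(ht i).1 h, mul_one]
      exact ⟨(hai i hi).le, mul_lt_of_le_one_of_lt h (hai i hi)⟩
    · have h1 := (ht i).2 h
      refine ⟨mul_le_one' (hai i hi).le (h1.trans (inv_le_one_of_one_le₀ h.le)), ?_⟩
      rw [mul_left_comm]
      refine mul_lt_of_lt_of_le_one (hai i hi) ?_
      calc w i y * w i t ≤ w i y * (w i y)⁻¹ := mul_le_mul_right h1 _
        _ = 1 := mul_inv_cancel₀ hyne
  by_contra! hcon
  have h1 : γ ^ N ≤ (w i (x₀ * (a * t))) ^ N := pow_le_pow_left' hcon N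
  have h2 : (w i (x₀ * (a * t))) ^ N = γ ^ N * (w i y * w i (a * t) ^ N) := by
    rw [hyi, map_mul, mul_pow, ← mul_assoc, mul_div_cancel₀ _ hγN]
  have h3 : w i y * w i (a * t) ^ N < 1 :=
    (mul_le_mul_right (pow_le_of_le_one zero_le hb.1 hN) _).trans_lt hb.2
  have h4 : γ ^ N * (w i y * w i (a * t) ^ N) < γ ^ N * 1 :=
    mul_lt_mul_of_pos_left h3 (zero_lt_iff.2 hγN)
  rw [h2] at h1
  rw [mul_one] at h4
  exact absurd h4 (not_lt.2 h1)
end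

section
/- (Fundamental inequality) Let v be a valuation on a field K, L a finite extension of K, and w_1, …, w_n pairwise distinct extensions of v to L. Then Σ_{i=1}^n e(w_i|v)·f(w_i|v) ≤ [L : K], where e(w_i|v) = [Γ_{w_i} : Γ_v] is the ramification index and f(w_i|v) = [κ_{w_i} : κ_v] is the residue degree. -/
namespace FundIneq

/-- Valuation independence over `K`: the value of a combination is the maximum. -/
def VI {K L Γ₀ ι : Type*} [Field K] [Field L] [Algebra K L] [LinearOrderedCommGroupWithZero Γ₀]
    (w : Valuation L Γ₀) (x : ι → L) : Prop :=
  ∀ (s : Finset ι) (a : ι → K) (k : ι), k ∈ s → a k ≠ 0 →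
    (∀ l ∈ s, w (a l • x l) ≤ w (a k • x k)) → ¬ w (∑ l ∈ s, a l • x l) < w (a k • x k)

section
variable {K L Γ₀ : Type*} [Field K] [Field L] [Algebra K L] [LinearOrderedCommGroupWithZero Γ₀]

lemma res_eq_zero (w : Valuation L Γ₀) (x : w.valuationSubring) :
    IsLocalRing.residue w.valuationSubring x = 0 ↔ w (x : L) < 1 := by
  rw [IsLocalRing.residue_eq_zero_iff, IsLocalRing.mem_maximalIdeal, mem_nonunits_iff]
  have h : IsUnit x ↔ w (x : L) = 1 :=
    (Valuation.integer.integers w).isUnit_iff_valuation_eq_one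
  have hx : w (x : L) ≤ 1 := x.2
  rw [h]
  exact ⟨fun h => lt_of_le_of_ne hx h, fun h => h.ne⟩

lemma vi_single {Q β : Type*} (v : Valuation K Γ₀) (w : Valuation L Γ₀)
    (hw : w.comap (algebraMap K L) = v)
    (hmem : ∀ y : K, y ∈ v.valuationSubring → algebraMap K L y ∈ w.valuationSubring)
    (φ : IsLocalRing.ResidueField v.valuationSubring →+*
      IsLocalRing.ResidueField w.valuationSubring)
    (hφ : ∀ x : v.valuationSubring, φ (IsLocalRing.residue v.valuationSubring x)
        = IsLocalRing.residue w.valuationSubring ⟨algebraMap K L x, hmem x x.2⟩)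
    (s : Q → L) (hs0 : ∀ q, s q ≠ 0)
    (hs : ∀ q q' (a a' : K), a ≠ 0 → a' ≠ 0 → v a * w (s q) = v a' * w (s q') → q = q')
    (b : β → w.valuationSubring)
    (hb : letI := φ.toModule; LinearIndependent (IsLocalRing.ResidueField v.valuationSubring)
      (fun i => IsLocalRing.residue w.valuationSubring (b i))) :
    VI (K := K) w (fun p : Q × β => s p.1 * (b p.2 : L)) := by
  classical
  have hv : ∀ a, w (algebraMap K L a) = v a := fun a => by rw [← hw]; rfl
  have hb1 : ∀ i, w (b i : L) = 1 := by
    intro i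
    let := φ.toModule
    have := hb.ne_zero i
    rw [Ne, res_eq_zero, not_lt] at this
    exact le_antisymm (b i).2 this
  have hval : ∀ (c : K) (p : Q × β), w (c • (s p.1 * (b p.2 : L))) = v c * w (s p.1) := by
    intro c p
    rw [Algebra.smul_def, map_mul, map_mul, hv, hb1, mul_one]
  intro t a k hk hak hmax hlt
  simp only [hval] at hmax hlt
  set M := v (a k) * w (s k.1) with hM
  have hM0 : M ≠ 0 := mul_ne_zero ((map_ne_zero v).2 hak) ((map_ne_zero w).2 (hs0 _))
  rw [← Finset.sum_filter_add_sum_filter_not t (fun l => l.1 = k.1)] at hlt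
  have h2 : w (∑ l ∈ t with ¬ l.1 = k.1, a l • (s l.1 * (b l.2 : L))) < M := by
    apply Valuation.map_sum_lt _ hM0
    intro l hl
    rw [Finset.mem_filter] at hl
    rw [hval]
    refine lt_of_le_of_ne (hmax l hl.1) fun h => hl.2 ?_
    have hal : a l ≠ 0 := by
      intro h0
      rw [h0, map_zero, zero_mul] at h
      exact hM0 h.symm
    exact hs _ _ _ _ hal hak h
  have h1 : w (∑ l ∈ t with l.1 = k.1, a l • (s l.1 * (b l.2 : L))) < M := by
    have := Valuation.map_sub_lt w hlt h2
    rwa [add_sub_cancel_right] at this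
  set T := t.filter (fun l => l.1 = k.1) with hT
  have hkT : k ∈ T := by simp [hT, hk]
  have hTk : ∀ l ∈ T, l.1 = k.1 ∧ l ∈ t := fun l hl => by
    rw [hT, Finset.mem_filter] at hl; exact ⟨hl.2, hl.1⟩
  have hvak : v (a k) ≠ 0 := (map_ne_zero v).2 hak
  have hwsk : w (s k.1) ≠ 0 := (map_ne_zero w).2 (hs0 _)
  have hc : ∀ l ∈ T, v (a l / a k) ≤ 1 := by
    intro l hl
    have := hmax l (hTk l hl).2
    rw [(hTk l hl).1, hM] at this
    have h3 := le_of_mul_le_mul_right this (zero_lt_iff.2 hwsk)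
    rw [map_div₀]
    exact div_le_one_of_le₀ h3 zero_le
  let c : Q × β → v.valuationSubring := fun l =>
    if h : v (a l / a k) ≤ 1 then ⟨a l / a k, h⟩ else 0
  have hcv : ∀ l ∈ T, (c l : K) = a l / a k := by
    intro l hl
    simp only [c, dif_pos (hc l hl)]
  have hsum : (∑ l ∈ T, a l • (s l.1 * (b l.2 : L))) =
      algebraMap K L (a k) * s k.1 *
        ((∑ l ∈ T, (⟨algebraMap K L (c l), hmem _ (c l).2⟩ : w.valuationSubring) * b l.2 :
          w.valuationSubring) : L) := by
    push_cast
    rw [Finset.mul_sum]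
    refine Finset.sum_congr rfl fun l hl => ?_
    rw [hcv l hl, (hTk l hl).1, map_div₀, Algebra.smul_def]
    have : algebraMap K L (a k) ≠ 0 := by simpa using hak
    field_simp
  rw [hsum, map_mul, map_mul, hv, ← hM] at h1
  have h4 : w ((∑ l ∈ T, (⟨algebraMap K L (c l), hmem _ (c l).2⟩ : w.valuationSubring) * b l.2 :
          w.valuationSubring) : L) < 1 := by
    by_contra h
    rw [not_lt] at h
    exact absurd h1 (not_lt.2 (le_mul_of_one_le_right zero_le h))
  rw [← res_eq_zero, map_sum] at h4
  let := φ.toModule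
  have hb' := linearIndependent_iff'.1 hb (T.image Prod.snd)
    (fun i => IsLocalRing.residue _ (c (k.1, i))) (by
      rw [Finset.sum_image]
      · rw [← h4]
        refine Finset.sum_congr rfl fun l hl => ?_
        rw [map_mul, ← hφ]
        have : (k.1, l.2) = l := by rw [← (hTk l hl).1]
        rw [this]
        rfl
      · intro l hl l' hl' h
        exact Prod.ext ((hTk l hl).1.trans (hTk l' hl').1.symm) h)
    k.2 (Finset.mem_image_of_mem _ hkT)
  rw [res_eq_zero] at hb'
  have : (c (k.1, k.2) : K) = 1 := by
    rw [Prod.mk.eta, hcv k hkT, div_self hak]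
  rw [this, map_one] at hb'
  exact lt_irrefl _ hb'

/-- Linear independence of the union of well-separated valuation independent families. -/
lemma linInd_union {I : Type*} [Fintype I] {ι : I → Type*} [∀ i, Fintype (ι i)]
    (w : I → Valuation L Γ₀)
    (hw : ∀ i j (a : K), w i (algebraMap K L a) = w j (algebraMap K L a))
    (x : ∀ i, ι i → L) (hx0 : ∀ i k, x i k ≠ 0) (hx : ∀ i, VI (K := K) (w i) (x i))
    (z : I → L) (hz : ∀ i, w i (z i) = 1)
    (hzx : ∀ i j, j ≠ i → ∀ k, w j (z i * x i k) < w i (x i k)) :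
    LinearIndependent K (fun p : (Σ i, ι i) => z p.1 * x p.1 p.2) := by
  classical
  rw [Fintype.linearIndependent_iff]
  intro a ha
  by_contra! hne
  obtain ⟨p0, hp0⟩ := hne
  have : Nonempty (Σ i, ι i) := ⟨p0⟩
  obtain ⟨⟨i, k⟩, hp⟩ := Finite.exists_max (fun p : Σ i, ι i => w p.1 (a p • x p.1 p.2))
  have hak : a ⟨i, k⟩ ≠ 0 := by
    intro h
    have := hp p0
    rw [h, zero_smul, map_zero, le_zero_iff, map_eq_zero, smul_eq_zero] at this
    exact this.elim hp0 (hx0 _ _)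
  have hM0 : w i (a ⟨i, k⟩ • x i k) ≠ 0 := by
    rw [map_ne_zero]; exact smul_ne_zero hak (hx0 _ _)
  rw [Fintype.sum_sigma, ← Finset.add_sum_erase _ _ (Finset.mem_univ i)] at ha
  apply hx i Finset.univ (fun l => a ⟨i, l⟩) k (Finset.mem_univ _) hak (fun l _ => hp ⟨i, l⟩)
  have h1 : ∑ l, a ⟨i, l⟩ • (z i * x i l) = z i * ∑ l, a ⟨i, l⟩ • x i l := by
    rw [Finset.mul_sum]
    exact Finset.sum_congr rfl fun l _ => by rw [mul_smul_comm]
  rw [← one_mul (w i (∑ l, _)), ← hz i, ← map_mul, ← h1, eq_neg_of_add_eq_zero_left ha,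
    Valuation.map_neg]
  apply Valuation.map_sum_lt _ hM0
  intro j hj
  apply Valuation.map_sum_lt _ hM0
  intro l _
  have hji : i ≠ j := (Finset.ne_of_mem_erase hj).symm
  by_cases h0 : a ⟨j, l⟩ = 0
  · rw [h0, zero_smul, map_zero]; exact zero_lt_iff.2 hM0
  refine lt_of_lt_of_le ?_ (hp ⟨j, l⟩)
  simp only [Algebra.smul_def]
  rw [map_mul (w i) (algebraMap K L _), map_mul (w j) (algebraMap K L _), hw j i]
  exact mul_lt_mul_of_pos_left (hzx j i hji l) (zero_lt_iff.2
    ((map_ne_zero (w i)).2 ((map_ne_zero (algebraMap K L)).2 h0)))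

lemma field_aux {F : Type*} [Field F] (a : F) :
    ∃ d : ℕ, 0 < d ∧ ∀ D : ℕ, 0 < D → d ∣ D → ∑ k ∈ Finset.range (D + 1), a ^ k ≠ 0 := by
  by_cases h1 : a = 1
  · subst h1
    rcases Nat.eq_zero_or_pos (ringChar F) with h | h
    · refine ⟨1, one_pos, fun D hD _ => ?_⟩
      have : CharP F 0 := h ▸ ringChar.charP F
      have := CharP.charP_to_charZero F
      simp only [one_pow, Finset.sum_const, Finset.card_range, nsmul_eq_mul, mul_one]
      exact Nat.cast_ne_zero.2 (Nat.succ_ne_zero D)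
    · refine ⟨ringChar F, h, fun D hD hd => ?_⟩
      have := (ringChar.spec F D).2 hd
      simp [this]
  · rcases Nat.eq_zero_or_pos (orderOf a) with h | h
    · refine ⟨1, one_pos, fun D hD _ h0 => ?_⟩
      have := geom_sum_mul a (D + 1)
      rw [h0, zero_mul] at this
      rw [orderOf_eq_zero_iff'] at h
      exact h (D + 1) D.succ_pos (sub_eq_zero.1 this.symm)
    · refine ⟨orderOf a, h, fun D hD hd h0 => ?_⟩
      have := geom_sum_mul a (D + 1)
      rw [h0, zero_mul, pow_succ, orderOf_dvd_iff_pow_eq_one.1 hd, one_mul] at this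
      exact h1 (sub_eq_zero.1 this.symm)

lemma val_aux (w : Valuation L Γ₀) (u : L) (hu : w u ≤ 1) :
    ∃ d : ℕ, 0 < d ∧ ∀ D : ℕ, 0 < D → d ∣ D →
      w (∑ k ∈ Finset.range (D + 1), u ^ k) = 1 := by
  obtain ⟨d, hd, h⟩ := field_aux (IsLocalRing.residue w.valuationSubring ⟨u, hu⟩)
  refine ⟨d, hd, fun D hD hdD => ?_⟩
  have := h D hD hdD
  simp only [← map_pow, ← map_sum] at this
  rw [Ne, res_eq_zero, not_lt] at this
  have h2 := (∑ k ∈ Finset.range (D + 1), (⟨u, hu⟩ : w.valuationSubring) ^ k).2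
  rw [Valuation.mem_valuationSubring_iff] at h2
  have h3 := le_antisymm h2 this
  push_cast at h3
  exact h3

lemma val_aux' (w : Valuation L Γ₀) (u : L) (hu : 1 < w u) (D : ℕ) :
    w (∑ k ∈ Finset.range (D + 1), u ^ k) = w u ^ D := by
  induction D with
  | zero => simp
  | succ D ih =>
    rw [Finset.sum_range_succ, Valuation.map_add_eq_of_lt_right, map_pow]
    rw [ih, map_pow]
    exact pow_lt_pow_right₀ hu (Nat.lt_succ_self D)

lemma lemA {I : Type*} [Fintype I] (w : I → Valuation L Γ₀) (u : L) :
    ∃ y : L, ∀ j, (w j u ≤ 1 → w j y = 1) ∧ (1 < w j u → w j y * w j u ≤ 1) := by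
  classical
  have : ∀ j, ∃ d : ℕ, 0 < d ∧ ∀ D : ℕ, 0 < D → d ∣ D → w j u ≤ 1 →
      w j (∑ k ∈ Finset.range (D + 1), u ^ k) = 1 := by
    intro j
    by_cases h : w j u ≤ 1
    · obtain ⟨d, hd, H⟩ := val_aux (w j) u h
      exact ⟨d, hd, fun D h1 h2 _ => H D h1 h2⟩
    · exact ⟨1, one_pos, fun _ _ _ h' => absurd h' h⟩
  choose d hd H using this
  have hD : 0 < ∏ j, d j := Finset.prod_pos fun j _ => hd j
  refine ⟨(∑ k ∈ Finset.range ((∏ j, d j) + 1), u ^ k)⁻¹, fun j => ⟨fun h => ?_, fun h => ?_⟩⟩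
  · rw [map_inv₀, H j _ hD (Finset.dvd_prod_of_mem d (Finset.mem_univ j)) h, inv_one]
  · rw [map_inv₀, val_aux' _ _ h]
    have h0 : 0 < w j u := lt_trans zero_lt_one h
    rw [inv_mul_le_one₀ (pow_pos h0 _)]
    exact le_self_pow₀ h.le hD.ne'

lemma lt_one_aux {a b : Γ₀} (h : a * b ≤ 1) (hb : 1 < b) : a < 1 := by
  by_contra! h'
  exact absurd (hb.trans_le ((le_mul_of_one_le_left zero_le h').trans h)) (lt_irrefl _)

/-- Approximation. -/
lemma lemB {I : Type*} [Fintype I] (w : I → Valuation L Γ₀)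
    (hw : ∀ i j (a : K), w i (algebraMap K L a) = w j (algebraMap K L a))
    (hdist : ∀ i j, i ≠ j → (w i).valuationSubring ≠ (w j).valuationSubring)
    (htor : ∀ i (x : L), x ≠ 0 → ∃ N : ℕ, 0 < N ∧ ∃ c : K, w i x ^ N = w i (algebraMap K L c))
    (i : I) {β : Type*} [Fintype β] (x : β → L) (hx : ∀ k, x k ≠ 0) :
    ∃ z : L, w i z = 1 ∧ ∀ j, j ≠ i → ∀ k, w j (z * x k) < w i (x k) := by
  classical
  have key : ∀ y : L, y ≠ 0 → ∃ u : L, ∃ N : ℕ, 0 < N ∧ w i u = 1 ∧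
      ∀ j, w j u = (w j y / w i y) ^ N := by
    intro y hy
    obtain ⟨N, hN, c, hc⟩ := htor i y hy
    have hu : ∀ j, w j (y ^ N / algebraMap K L c) = (w j y / w i y) ^ N := by
      intro j
      rw [map_div₀, map_pow, hw j i, ← hc, div_pow]
    refine ⟨y ^ N / algebraMap K L c, N, hN, ?_, hu⟩
    rw [hu, div_self ((map_ne_zero _).2 hy), one_pow]
  have sep : ∀ j, ∃ y : L, w i y = 1 ∧ (∀ l, w l y ≤ 1) ∧ (j ≠ i → w j y < 1) := by
    intro j
    by_cases hji : j = i
    · exact ⟨1, by simp, fun l => by simp, fun h => absurd hji h⟩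
    have : ∃ y : L, y ≠ 0 ∧ w i y < w j y := by
      by_contra! hcon
      apply hdist j i hji
      have heq : ∀ y, w i y = w j y := by
        intro y
        by_cases hy : y = 0
        · simp [hy]
        refine le_antisymm ?_ (hcon y hy)
        have := hcon y⁻¹ (inv_ne_zero hy)
        rw [map_inv₀, map_inv₀] at this
        exact (inv_le_inv₀ (zero_lt_iff.2 ((map_ne_zero _).2 hy))
          (zero_lt_iff.2 ((map_ne_zero _).2 hy))).1 this
      ext y
      rw [Valuation.mem_valuationSubring_iff, Valuation.mem_valuationSubring_iff, heq]
    obtain ⟨y0, hy0, hlt⟩ := this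
    obtain ⟨u, N, hN, hu1, hu⟩ := key y0 hy0
    have hju : 1 < w j u := by
      rw [hu]
      apply one_lt_pow₀ _ hN.ne'
      rwa [one_lt_div₀ (zero_lt_iff.2 ((map_ne_zero _).2 hy0))]
    obtain ⟨y, hy⟩ := lemA w u
    refine ⟨y, (hy i).1 hu1.le, fun l => ?_, fun _ => ?_⟩
    · rcases le_or_gt (w l u) 1 with h | h
      · exact ((hy l).1 h).le
      · exact (lt_one_aux ((hy l).2 h) h).le
    · exact lt_one_aux ((hy j).2 hju) hju
  have app : ∀ k, ∃ y : L, w i y = 1 ∧ (∀ l, w l y ≤ 1) ∧ ∀ l, w l y * w l (x k) ≤ w i (x k) := by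
    intro k
    obtain ⟨u, N, hN, hu1, hu⟩ := key (x k) (hx k)
    obtain ⟨y, hy⟩ := lemA w u
    have hpos : 0 < w i (x k) := zero_lt_iff.2 ((map_ne_zero _).2 (hx k))
    have hle : ∀ l, w l y ≤ 1 := by
      intro l
      rcases le_or_gt (w l u) 1 with h | h
      · exact ((hy l).1 h).le
      · exact (lt_one_aux ((hy l).2 h) h).le
    refine ⟨y, (hy i).1 hu1.le, hle, fun l => ?_⟩
    rcases le_or_gt (w l (x k)) (w i (x k)) with h | h
    · exact (mul_le_of_le_one_left zero_le (hle l)).trans h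
    · have h1 : 1 < w l (x k) / w i (x k) := by rwa [one_lt_div₀ hpos]
      have h2 : w l (x k) / w i (x k) ≤ w l u := by
        rw [hu]; exact le_self_pow₀ h1.le hN.ne'
      have h3 := (mul_le_mul_right h2 (w l y)).trans ((hy l).2 (h1.trans_le h2))
      rwa [← mul_div_assoc, div_le_one₀ hpos] at h3
  choose y hy1 hy2 hy3 using sep
  choose t ht1 ht2 ht3 using app
  refine ⟨(∏ j, y j) * ∏ k, t k, by simp [hy1, ht1], fun j hj k => ?_⟩
  have hp1 : w j (∏ l, y l) < 1 := by
    rw [← Finset.mul_prod_erase _ _ (Finset.mem_univ j), map_mul]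
    refine mul_lt_one_of_lt_of_le (hy3 j hj) ?_
    rw [map_prod]
    exact Finset.prod_le_one' fun l _ => hy2 l j
  have hp2 : w j (∏ k, t k) * w j (x k) ≤ w i (x k) := by
    rw [← Finset.mul_prod_erase _ _ (Finset.mem_univ k), map_mul, mul_right_comm]
    refine (mul_le_of_le_one_right zero_le ?_).trans (ht3 k j)
    rw [map_prod]
    exact Finset.prod_le_one' fun l _ => ht2 l j
  have hpos : 0 < w i (x k) := zero_lt_iff.2 ((map_ne_zero _).2 (hx k))
  rw [map_mul, map_mul, mul_assoc]
  calc _ ≤ w j (∏ l, y l) * w i (x k) := mul_le_mul_right hp2 _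
    _ < 1 * w i (x k) := mul_lt_mul_of_pos_right hp1 hpos
    _ = _ := one_mul _


lemma exists_family {K L Γ₀ : Type u} [Field K] [Field L] [Algebra K L]
    [LinearOrderedCommGroupWithZero Γ₀]
    (v : Valuation K Γ₀) (w : Valuation L Γ₀)
    (hw : w.comap (algebraMap K L) = v)
    (hmem : ∀ y : K, y ∈ v.valuationSubring → algebraMap K L y ∈ w.valuationSubring)
    (φ : IsLocalRing.ResidueField v.valuationSubring →+*
      IsLocalRing.ResidueField w.valuationSubring)
    (hφ : ∀ x : v.valuationSubring, φ (IsLocalRing.residue v.valuationSubring x)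
        = IsLocalRing.residue w.valuationSubring ⟨algebraMap K L x, hmem x x.2⟩) :
    ∃ (β : Type u) (_ : Nonempty β)
      (x : (w.valueGroup ⧸ v.valueGroup.subgroupOf w.valueGroup) × β → L),
      Cardinal.mk β = @Module.rank (IsLocalRing.ResidueField v.valuationSubring)
              (IsLocalRing.ResidueField w.valuationSubring) _ _ φ.toModule ∧
      (∀ k, x k ≠ 0) ∧ VI (K := K) w x := by
  letI := φ.toModule
  have hv : ∀ a, w (algebraMap K L a) = v a := fun a => by rw [← hw]; rfl
  let B := Module.Free.chooseBasis (IsLocalRing.ResidueField v.valuationSubring)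
    (IsLocalRing.ResidueField w.valuationSubring)
  have hs : ∀ q : w.valueGroup ⧸ v.valueGroup.subgroupOf w.valueGroup,
      ∃ s : Lˣ, Units.map w.toMonoidWithZeroHom.toMonoidHom s = (q.out : Γ₀ˣ) :=
    fun q => q.out.2
  choose s hs using hs
  have hb : ∀ i, ∃ b, IsLocalRing.residue w.valuationSubring b = B i := fun i =>
    IsLocalRing.residue_surjective _
  choose b hb using hb
  have hli : LinearIndependent (IsLocalRing.ResidueField v.valuationSubring)
      (fun i => IsLocalRing.residue w.valuationSubring (b i)) := by
    simp only [hb]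
    exact B.linearIndependent
  refine ⟨_, B.index_nonempty, fun p => (s p.1 : L) * (b p.2 : L), ?_, ?_, ?_⟩
  · exact B.mk_eq_rank''
  · intro k
    refine mul_ne_zero (s k.1).ne_zero fun h0 => ?_
    have := hli.ne_zero k.2
    rw [Ne, res_eq_zero, h0, map_zero] at this
    exact this zero_lt_one
  · refine vi_single v w hw hmem φ hφ (fun q => (s q : L)) (fun q => (s q).ne_zero) ?_ b hli
    intro q q' a a' ha ha' h
    rw [← QuotientGroup.out_eq' q, ← QuotientGroup.out_eq' q', QuotientGroup.eq,
      Subgroup.mem_subgroupOf]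
    refine ⟨Units.mk0 a ha * (Units.mk0 a' ha')⁻¹, ?_⟩
    push_cast
    rw [← hs q, ← hs q']
    ext
    have h1 : v a' ≠ 0 := (map_ne_zero _).2 ha'
    have h2 : w (s q) ≠ 0 := (map_ne_zero _).2 (s q).ne_zero
    have : v (a * a'⁻¹) = (w (s q))⁻¹ * w (s q') := by
      rw [map_mul, map_inv₀, ← div_eq_mul_inv, ← div_eq_inv_mul, div_eq_div_iff h1 h2, h, mul_comm]
    simpa using this


lemma vi_linInd {ι : Type*} (w : Valuation L Γ₀) (x : ι → L) (hx0 : ∀ k, x k ≠ 0)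
    (hx : VI (K := K) w x) : LinearIndependent K x := by
  rw [linearIndependent_iff']
  intro s a ha i hi
  by_contra hai
  obtain ⟨k, hk, hmax⟩ := Finset.exists_max_image s (fun l => w (a l • x l)) ⟨i, hi⟩
  have hi0 : 0 < w (a i • x i) := zero_lt_iff.2 ((map_ne_zero _).2 (smul_ne_zero hai (hx0 i)))
  have hk0 := hi0.trans_le (hmax i hi)
  have hak : a k ≠ 0 := by
    intro h
    rw [h, zero_smul, map_zero] at hk0
    exact lt_irrefl _ hk0
  apply hx s a k hk hak hmax
  rw [ha, map_zero]
  exact hk0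

end

end FundIneq


/-- **Fundamental inequality.**  Let `v` be a valuation on a field `K`, `L` a finite extension
of `K`, and `w₁, …, w_n` pairwise distinct extensions of `v` to `L` (their values taken in a
common value group).  Then `∑ i, e(wᵢ|v)·f(wᵢ|v) ≤ [L : K]`, where the ramification index
`e(wᵢ|v) = [Γ_{wᵢ} : Γ_v]` is the cardinality of the coset space `Γ_{wᵢ}/Γ_v` and the residue
degree `f(wᵢ|v) = [κ_{wᵢ} : κ_v]` is the dimension of `κ_{wᵢ}` over `κ_v`. -/
theorem fundamental_inequality
    {K L Γ₀ : Type u} [Field K] [Field L] [Algebra K L] [FiniteDimensional K L]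
    [LinearOrderedCommGroupWithZero Γ₀]
    {n : ℕ} (v : Valuation K Γ₀) (w : Fin n → Valuation L Γ₀)
    (hw : ∀ i, (w i).comap (algebraMap K L) = v)
    (hdist : ∀ i j, i ≠ j → (w i).valuationSubring ≠ (w j).valuationSubring)
    (hmem : ∀ (i) (y : K), y ∈ v.valuationSubring → algebraMap K L y ∈ (w i).valuationSubring)
    (φ : (i : Fin n) → (IsLocalRing.ResidueField v.valuationSubring →+*
      IsLocalRing.ResidueField (w i).valuationSubring))
    (hφ : ∀ (i : Fin n) (x : v.valuationSubring),
      φ i (IsLocalRing.residue v.valuationSubring x)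
        = IsLocalRing.residue (w i).valuationSubring ⟨algebraMap K L x, hmem i x x.2⟩) :
    ∑ i : Fin n,
        Cardinal.mk ((w i).valueGroup ⧸ v.valueGroup.subgroupOf (w i).valueGroup)
          * @Module.rank (IsLocalRing.ResidueField v.valuationSubring)
              (IsLocalRing.ResidueField (w i).valuationSubring) _ _ (φ i).toModule
      ≤ Module.rank K L := by
  classical
  have hv : ∀ i a, w i (algebraMap K L a) = v a := fun i a => by rw [← hw i]; rfl
  have hww : ∀ i j (a : K), w i (algebraMap K L a) = w j (algebraMap K L a) := fun i j a => by
    rw [hv, hv]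
  have := fun i => FundIneq.exists_family v (w i) (hw i) (hmem i) (φ i) (hφ i)
  choose β hβ x hcard hx0 hVI using this
  have hfin : ∀ i, Finite (((w i).valueGroup ⧸ v.valueGroup.subgroupOf (w i).valueGroup) × β i) :=
    fun i => (FundIneq.vi_linInd (w i) (x i) (hx0 i) (hVI i)).finite
  have := fun i => Fintype.ofFinite
    (((w i).valueGroup ⧸ v.valueGroup.subgroupOf (w i).valueGroup) × β i)
  have htor : ∀ i (x : L), x ≠ 0 → ∃ N : ℕ, 0 < N ∧ ∃ c : K,
      w i x ^ N = w i (algebraMap K L c) := by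
    intro i x hx
    have hq : Finite ((w i).valueGroup ⧸ v.valueGroup.subgroupOf (w i).valueGroup) :=
      Finite.prod_left (β i)
    have hfi : (v.valueGroup.subgroupOf (w i).valueGroup).FiniteIndex :=
      Subgroup.finiteIndex_of_finite_quotient
    refine ⟨(v.valueGroup.subgroupOf (w i).valueGroup).index,
      Nat.pos_of_ne_zero hfi.index_ne_zero, ?_⟩
    have := Subgroup.pow_index_mem (v.valueGroup.subgroupOf (w i).valueGroup)
      ⟨Units.map (w i).toMonoidWithZeroHom.toMonoidHom (Units.mk0 x hx), ⟨Units.mk0 x hx, rfl⟩⟩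
    rw [Subgroup.mem_subgroupOf] at this
    obtain ⟨c, hc⟩ := this
    refine ⟨c, ?_⟩
    rw [hv]
    have h2 := congrArg (fun g : Γ₀ˣ => (g : Γ₀)) hc
    simpa using h2.symm
  have := fun i => FundIneq.lemB w hww hdist htor i (x i) (hx0 i)
  choose z hz hzx using this
  have hli := FundIneq.linInd_union w hww x hx0 hVI z hz hzx
  have hle := hli.cardinal_le_rank
  rw [Cardinal.mk_fintype, Fintype.card_sigma, Nat.cast_sum] at hle
  refine le_trans (le_of_eq ?_) hle
  refine Finset.sum_congr rfl fun i _ => ?_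
  rw [← hcard i, ← Cardinal.mk_fintype, Cardinal.mk_prod, Cardinal.lift_id, Cardinal.lift_id]
end
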